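/- Let h : K → K be a homeomorphism. Then there exists an integer a such that h is isotopic to σ̂^a (where σ̂^a denotes the a-th iterate of σ̂ when a ≥ 0 and the |a|-th iterate of σ̂^{−1} when a < 0). -/

import Mathlib

open Set Filter Topology Function

noncomputable section

/-- The tent map with slope `s`. -/
def tent (s : ℝ) (x : ℝ) : ℝ := min (s * x) (s * (1 - x))

/-- The ω-limit set of `c` under iteration of `f`. -/
def omegaSet (f : ℝ → ℝ) (c : ℝ) : Set ℝ :=
  {y | ∃ φ : ℕ → ℕ, StrictMono φ ∧ Tendsto (fun k => f^[φ k] c) atTop (𝓝 y)}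

/-- The inverse limit space `K = lim←([0,1], T)`, as a subset of `ℕ → ℝ`. -/
def invLim (s : ℝ) : Set (ℕ → ℝ) :=
  {x | (∀ n, x n ∈ Icc (0 : ℝ) 1) ∧ ∀ n, x n = tent s (x (n + 1))}

/-- The `n`-th coordinate projection `π_n : K → [0,1]`. -/
def proj (s : ℝ) (n : ℕ) (x : invLim s) : ℝ := (x : ℕ → ℝ) n

/-- The inverse shift homeomorphism `σ̂⁻¹(x₀,x₁,…) = (x₁,x₂,…)` as a map `K → K`. -/
def shiftInvFun (s : ℝ) (x : invLim s) : invLim s :=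
  ⟨fun n => (x : ℕ → ℝ) (n + 1), fun n => x.2.1 (n + 1), fun n => x.2.2 (n + 1)⟩

/-- The shift homeomorphism `σ̂(x₀,x₁,…) = (T x₀, x₀, x₁, …)` as a map `K → K`. -/
def shiftFwdFun (s : ℝ) (hs1 : Real.sqrt 2 < s) (hs2 : s < 2) (x : invLim s) : invLim s := by
  refine ⟨fun n => Nat.casesOn n (tent s ((x : ℕ → ℝ) 0)) (fun k => (x : ℕ → ℝ) k), ?_, ?_⟩
  · intro n
    cases n with
    | zero =>
      have hx0 := x.2.1 0
      have hs0 : 0 ≤ s := le_of_lt (lt_of_le_of_lt (Real.sqrt_nonneg 2) hs1)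
      constructor
      · exact le_min (mul_nonneg hs0 hx0.1) (mul_nonneg hs0 (by linarith [hx0.2]))
      · rcases le_total ((x : ℕ → ℝ) 0) (1 / 2) with hc | hc
        · exact le_trans (min_le_left _ _) (by nlinarith [hx0.1, hx0.2])
        · exact le_trans (min_le_right _ _) (by nlinarith [hx0.1, hx0.2])
    | succ k => exact x.2.1 k
  · intro n
    cases n with
    | zero => rfl
    | succ k => exact x.2.2 k

/-- The integer power `σ̂^b` of the shift homeomorphism : for `b ≥ 0` it is the `b`-th iterate
of `σ̂`, and for `b < 0` the `|b|`-th iterate of `σ̂⁻¹`. -/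
def shiftZ (s : ℝ) (hs1 : Real.sqrt 2 < s) (hs2 : s < 2) (b : ℤ) : invLim s → invLim s :=
  if 0 ≤ b then (shiftFwdFun s hs1 hs2)^[b.toNat] else (shiftInvFun s)^[(-b).toNat]

/-- The set `F` of folding points of `K`. -/
def foldingPts (s : ℝ) : Set (invLim s) :=
  {x | ∀ n, proj s n x ∈ omegaSet (tent s) (1 / 2)}

/-- The set `E_p` of `p`-points of `K`. -/
def pPoints (s : ℝ) (p : ℕ) : Set (invLim s) :=
  {x | ∃ n, p < n ∧ proj s n x = 1 / 2}

/-- `A` is an arc with endpoints `a` and `b`. -/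
def IsArcWith {X : Type*} [TopologicalSpace X] (A : Set X) (a b : X) : Prop :=
  ∃ f : unitInterval → X, Topology.IsEmbedding f ∧ range f = A ∧ f 0 = a ∧ f 1 = b

/-- `A` is an arc (a homeomorphic copy of `[0,1]`). -/
def IsArc {X : Type*} [TopologicalSpace X] (A : Set X) : Prop :=
  ∃ a b, IsArcWith A a b

/-- `A` is an arc with endpoints `a`, `b`, possibly degenerate (a single point when `a = b`). -/
def IsArcBtw {X : Type*} [TopologicalSpace X] (A : Set X) (a b : X) : Prop :=
  IsArcWith A a b ∨ (a = b ∧ A = {a})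

/-- `A` is an arc, possibly degenerate (i.e. a single point). -/
def IsArcOrPoint {X : Type*} [TopologicalSpace X] (A : Set X) : Prop :=
  IsArc A ∨ ∃ x, A = {x}

/-- The composant of a point `x`: the union of all proper subcontinua containing `x`. -/
def composant {X : Type*} [TopologicalSpace X] (x : X) : Set X :=
  {y | ∃ A : Set X, IsCompact A ∧ IsConnected A ∧ A ≠ univ ∧ x ∈ A ∧ y ∈ A}

/-- `g` preserves the order along composants: for every composant `C` and every continuous
bijection `φ` from `ℝ` (respectively from `[0,∞)`) onto `C`, the map `φ⁻¹ ∘ g ∘ φ` is strictly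
increasing. -/
def PreservesCompOrder {X : Type*} [TopologicalSpace X] (g : X → X) : Prop :=
  ∀ x : X,
    (∀ φ : ℝ → X, Continuous φ → Injective φ → range φ = composant x →
      ∀ t t' u u' : ℝ, g (φ t) = φ u → g (φ t') = φ u' → t < t' → u < u') ∧
    (∀ φ : {r : ℝ // (0 : ℝ) ≤ r} → X, Continuous φ → Injective φ → range φ = composant x →
      ∀ t t' u u', g (φ t) = φ u → g (φ t') = φ u' → t < t' → u < u')

/-- Two self-maps of `X` are isotopic if there is a continuous `H : X × [0,1] → X` joining them
through homeomorphisms. -/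
def Isotopic {X : Type*} [TopologicalSpace X] (f g : X → X) : Prop :=
  ∃ H : X × unitInterval → X, Continuous H ∧ (∀ x, H (x, 0) = f x) ∧ (∀ x, H (x, 1) = g x) ∧
    ∀ t : unitInterval, IsHomeomorph fun x => H (x, t)

/-- The topological limsup of a sequence of subsets. -/
def setLimsup {X : Type*} [TopologicalSpace X] (D : ℕ → Set X) : Set X :=
  {y | ∃ φ : ℕ → ℕ, StrictMono φ ∧ ∃ z : ℕ → X, (∀ k, z k ∈ D (φ k)) ∧
    Tendsto z atTop (𝓝 y)}

/-- The point `0̄ = (0,0,0,…)` of `K` (an endpoint of `K`). -/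
def zeroPt (s : ℝ) (hs1 : Real.sqrt 2 < s) : invLim s := by
  refine ⟨fun _ => 0, fun n => ⟨le_refl 0, zero_le_one⟩, fun n => ?_⟩
  have hs0 : 0 ≤ s := le_of_lt (lt_of_le_of_lt (Real.sqrt_nonneg 2) hs1)
  simp [tent]
  exact hs0


/-- standing numerical assumptions -/
structure Ctx (s δ : ℝ) : Prop where
  h1 : 1 < s
  h2 : s < 2
  hd0 : 0 < δ
  hd : δ ≤ 1 / 2
  gap : ∀ k : ℕ, 1 ≤ k → δ ≤ |(tent s)^[k] (1 / 2) - 1 / 2|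

theorem Ctx.b0 {s δ : ℝ} (C : Ctx s δ) (r : ℕ) : 0 < s ^ r := pow_pos (by linarith [C.h1]) r
theorem Ctx.s0 {s δ : ℝ} (C : Ctx s δ) : 0 < s := by linarith [C.h1]
theorem Ctx.b1 {s δ : ℝ} (C : Ctx s δ) (r : ℕ) : 1 ≤ s ^ r := one_le_pow₀ C.h1.le

theorem Ctx.bmono {s δ : ℝ} (C : Ctx s δ) {i j : ℕ} (h : i ≤ j) : s ^ i ≤ s ^ j :=
  pow_le_pow_right₀ C.h1.le h

theorem Ctx.big {s δ : ℝ} (C : Ctx s δ) (t : ℝ) : ∃ N : ℕ, ∀ n, N ≤ n → t < s ^ n := by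
  obtain ⟨N, hN⟩ := pow_unbounded_of_one_lt t C.h1
  exact ⟨N, fun n hn => lt_of_lt_of_le hN (C.bmono hn)⟩

theorem exists_ctx (s : ℝ) (h1 : 1 < s) (h2 : s < 2)
    (hnr : (1 : ℝ) / 2 ∉ omegaSet (tent s) (1 / 2)) : ∃ δ, Ctx s δ := by
  by_contra hcon
  have H : ∀ δ : ℝ, 0 < δ → ∃ k : ℕ, 1 ≤ k ∧ |(tent s)^[k] (1 / 2) - 1 / 2| < δ := by
    intro δ hδ
    by_contra h
    push Not at h
    exact hcon ⟨min δ (1/2), h1, h2, by positivity, min_le_right _ _,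
      fun k hk => le_trans (min_le_left _ _) (h k hk)⟩
  apply hnr
  by_cases hp : ∃ k : ℕ, 1 ≤ k ∧ (tent s)^[k] (1 / 2) = 1 / 2
  · obtain ⟨k, hk, hkk⟩ := hp
    refine ⟨fun n => k * n, fun a b hab => Nat.mul_lt_mul_of_pos_left hab hk, ?_⟩
    have : ∀ n : ℕ, (tent s)^[k * n] (1 / 2) = 1 / 2 := by
      intro n
      rw [Function.iterate_mul]
      exact Function.iterate_fixed hkk n
    simp only [this]
    exact tendsto_const_nhds
  · push Not at hp
    have H2 : ∀ N : ℕ, ∀ δ : ℝ, 0 < δ → ∃ k, N < k ∧ |(tent s)^[k] (1 / 2) - 1 / 2| < δ := by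
      intro N
      induction N with
      | zero => intro δ hδ; obtain ⟨k, hk, hk2⟩ := H δ hδ; exact ⟨k, hk, hk2⟩
      | succ N ih =>
        intro δ hδ
        obtain ⟨k, hk, hk2⟩ := ih (min δ |(tent s)^[N+1] (1 / 2) - 1 / 2|)
          (lt_min hδ (abs_pos.2 (sub_ne_zero.2 (hp _ (by omega)))))
        refine ⟨k, ?_, lt_of_lt_of_le hk2 (min_le_left _ _)⟩
        rcases Nat.lt_or_ge (N+1) k with h | h
        · exact h
        · have : k = N + 1 := by omega
          subst this
          exact absurd (lt_of_lt_of_le hk2 (min_le_right _ _)) (lt_irrefl _)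
    choose ψ hψ using fun N : ℕ => fun n : ℕ => H2 N (1 / ((n : ℝ) + 1)) (by positivity)
    let f : ℕ → ℕ := fun n => Nat.rec (ψ 0 0) (fun m p => ψ p (m+1)) n
    refine ⟨f, strictMono_nat_of_lt_succ (fun n => (hψ (f n) (n+1)).1), ?_⟩
    rw [tendsto_iff_dist_tendsto_zero]
    refine squeeze_zero (fun _ => dist_nonneg) (fun n => ?_) tendsto_one_div_add_atTop_nhds_zero_nat
    rw [Real.dist_eq]
    cases n with
    | zero => simpa [f] using (hψ 0 0).2.le
    | succ n => exact (hψ (f n) (n+1)).2.le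

/-- the ray coordinate function -/
def rayF (s t : ℝ) : ℝ :=
  (tent s)^[sInf {N : ℕ | t ≤ s ^ N / 2}] (t / s ^ (sInf {N : ℕ | t ≤ s ^ N / 2}))

/-- rescaled ray coordinate functions -/
def ff (s : ℝ) (r : ℕ) (t : ℝ) : ℝ := s ^ r * rayF s (t / s ^ r)

theorem rayF_aux {s δ : ℝ} (C : Ctx s δ) (t : ℝ) (N k : ℕ) (h : t ≤ s ^ N / 2) :
    (tent s)^[N + k] (t / s ^ (N + k)) = (tent s)^[N] (t / s ^ N) := by
  induction k with
  | zero => rfl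
  | succ k ih =>
    rw [← ih, ← add_assoc, Function.iterate_succ_apply]
    congr 1
    have hb := C.b0 (N + k)
    have hs := C.s0
    have h3 : s ^ N ≤ s ^ (N + k + 1) := C.bmono (by omega)
    have h4 : t / s ^ (N + k + 1) ≤ 1 / 2 := by
      rw [div_le_iff₀ (C.b0 _)]; linarith
    have h5 : s * (t / s ^ (N + k + 1)) = t / s ^ (N + k) := by
      rw [pow_succ]; field_simp
    rw [tent, min_eq_left (by nlinarith), h5]

theorem rayF_eq {s δ : ℝ} (C : Ctx s δ) (t : ℝ) (N : ℕ) (h : t ≤ s ^ N / 2) :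
    rayF s t = (tent s)^[N] (t / s ^ N) := by
  have hmem : sInf {N : ℕ | t ≤ s ^ N / 2} ∈ {N : ℕ | t ≤ s ^ N / 2} := Nat.sInf_mem ⟨N, h⟩
  have hle : sInf {N : ℕ | t ≤ s ^ N / 2} ≤ N := Nat.sInf_le h
  obtain ⟨k, hk⟩ := Nat.exists_eq_add_of_le hle
  rw [rayF, hk]
  exact (rayF_aux C t _ k hmem).symm

theorem rayF_mul {s δ : ℝ} (C : Ctx s δ) (t : ℝ) : rayF s (s * t) = tent s (rayF s t) := by
  obtain ⟨N, hN⟩ := C.big (2 * |t|)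
  have h1 := hN N le_rfl
  have h2 : t ≤ s ^ N / 2 := by linarith [le_abs_self t]
  have hs := C.s0
  have h3 : s * t ≤ s ^ (N + 1) / 2 := by rw [pow_succ]; nlinarith
  rw [rayF_eq C t N h2, rayF_eq C _ (N+1) h3, Function.iterate_succ_apply', pow_succ]
  congr 2
  have := (C.b0 N).ne'
  field_simp

theorem rayF_mul_pow {s δ : ℝ} (C : Ctx s δ) (k : ℕ) (t : ℝ) :
    rayF s (s ^ k * t) = (tent s)^[k] (rayF s t) := by
  induction k with
  | zero => simp
  | succ k ih => rw [pow_succ', mul_assoc, rayF_mul C, ih, Function.iterate_succ_apply']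

theorem rayF_id {s δ : ℝ} (C : Ctx s δ) (t : ℝ) (h : t ≤ s / 2) : rayF s t = t := by
  have hs := C.s0
  rw [rayF_eq C t 1 (by simpa using h)]
  simp only [Function.iterate_one, pow_one, tent]
  have h5 : s * (t / s) = t := by field_simp
  have h6 : s * (1 - t / s) = s - t := by field_simp
  rw [h5, h6, min_eq_left (by linarith)]

theorem ff_id {s δ : ℝ} (C : Ctx s δ) {r : ℕ} {t : ℝ} (h : t ≤ s ^ (r + 1) / 2) :
    ff s r t = t := by
  have hb := C.b0 r
  rw [ff, rayF_id C]
  · field_simp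
  · rw [div_le_iff₀ hb]; rw [pow_succ] at h; linarith

theorem ff_succ {s δ : ℝ} (C : Ctx s δ) (r : ℕ) (t : ℝ) :
    ff s r t = min (ff s (r + 1) t) (s ^ (r + 1) - ff s (r + 1) t) := by
  have hb := C.b0 r
  have hs := C.s0
  have h : t / s ^ r = s * (t / s ^ (r + 1)) := by rw [pow_succ]; field_simp
  rw [ff, ff, h, rayF_mul C, tent, mul_min_of_nonneg _ _ hb.le]
  congr 1 <;> rw [pow_succ] <;> ring

theorem ff_iter {s δ : ℝ} (C : Ctx s δ) (i k : ℕ) (t : ℝ) :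
    ff s i t = s ^ i * (tent s)^[k] (ff s (i + k) t / s ^ (i + k)) := by
  have hb := C.b0 (i + k)
  have hb := C.b0 i
  have hb := C.b0 k
  have h : t / s ^ i = s ^ k * (t / s ^ (i + k)) := by rw [pow_add]; field_simp
  rw [ff, ff, h, rayF_mul_pow C]
  congr 2
  field_simp

theorem ff_scale {s δ : ℝ} (C : Ctx s δ) (r k : ℕ) (t : ℝ) :
    ff s (r + k) (s ^ k * t) = s ^ k * ff s r t := by
  have hb := C.b0 r
  have hb := C.b0 k
  rw [ff, ff, pow_add, show s ^ k * t / (s ^ r * s ^ k) = t / s ^ r by field_simp]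
  ring

/-- downward induction on levels -/
theorem down_ind {s δ : ℝ} (C : Ctx s δ) (y : ℝ) (P : ℕ → Prop)
    (hbase : ∀ r, y ≤ s ^ (r + 1) / 2 → P r) (p : ℕ)
    (hstep : ∀ r, p ≤ r → P (r + 1) → P r) : P p := by
  obtain ⟨N, hN⟩ := C.big (2 * y)
  have : ∀ k, k ≤ N → P (p + (N - k)) := by
    intro k
    induction k with
    | zero =>
      intro _
      refine hbase _ ?_
      have := hN (p + (N - 0) + 1) (by omega)
      linarith
    | succ k ih =>
      intro hk
      have := ih (by omega)
      rw [show p + (N - k) = p + (N - (k+1)) + 1 by omega] at this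
      exact hstep _ (by omega) this
  simpa using this N le_rfl

theorem ff_lip {s δ : ℝ} (C : Ctx s δ) (r : ℕ) (x y : ℝ) : |ff s r x - ff s r y| ≤ |x - y| := by
  refine down_ind C (max x y) (fun r => |ff s r x - ff s r y| ≤ |x - y|) ?_ r ?_
  · intro r hr
    rw [ff_id C (le_trans (le_max_left _ _) hr), ff_id C (le_trans (le_max_right _ _) hr)]
  · intro r _ h
    refine le_trans ?_ h
    rw [ff_succ C r x, ff_succ C r y]
    refine le_trans (abs_min_sub_min_le_max _ _ _ _) ?_
    rw [sub_sub_sub_cancel_left, abs_sub_comm (ff s (r+1) y)]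
    simp

theorem ff_cont {s δ : ℝ} (C : Ctx s δ) (r : ℕ) : Continuous (ff s r) := by
  have : LipschitzWith 1 (ff s r) := LipschitzWith.of_dist_le_mul (fun x y => by
    simpa [Real.dist_eq] using ff_lip C r x y)
  exact this.continuous

theorem ff_le {s δ : ℝ} (C : Ctx s δ) (r : ℕ) (t : ℝ) : ff s r t ≤ s ^ (r + 1) / 2 := by
  rw [ff_succ C]
  rcases le_total (ff s (r+1) t) (s^(r+1)/2) with h | h
  · exact le_trans (min_le_left _ _) h
  · exact le_trans (min_le_right _ _) (by linarith)

theorem ff_nonneg {s δ : ℝ} (C : Ctx s δ) (r : ℕ) {t : ℝ} (ht : 0 ≤ t) : 0 ≤ ff s r t := by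
  refine down_ind C t (fun r => 0 ≤ ff s r t) ?_ r ?_
  · intro r hr; rw [ff_id C hr]; exact ht
  · intro r _ h
    rw [ff_succ C]
    refine le_min h ?_
    have h2 := ff_le C (r+1) t
    have h3 := C.b0 (r+1)
    rw [pow_succ] at h2
    nlinarith [C.h2]

theorem ff_le_self {s δ : ℝ} (C : Ctx s δ) (r : ℕ) {t : ℝ} : ff s r t ≤ t := by
  refine down_ind C t (fun r => ff s r t ≤ t) ?_ r ?_
  · intro r hr; rw [ff_id C hr]
  · intro r _ h
    rw [ff_succ C]
    exact le_trans (min_le_left _ _) h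

theorem ff_eq_of_eq {s δ : ℝ} (C : Ctx s δ) {q r : ℕ} (h : q ≤ r) {x y : ℝ}
    (hxy : ff s r x = ff s r y) : ff s q x = ff s q y := by
  obtain ⟨k, rfl⟩ := Nat.exists_eq_add_of_le h
  rw [ff_iter C q k x, ff_iter C q k y, hxy]

theorem ff_eq_of_sum {s δ : ℝ} (C : Ctx s δ) {q r : ℕ} (h : q < r) {x y : ℝ}
    (hxy : ff s r x + ff s r y = s ^ r) : ff s q x = ff s q y := by
  obtain ⟨k, rfl⟩ := Nat.exists_eq_add_of_lt h
  refine ff_eq_of_eq C (show q ≤ q + k by omega) ?_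
  rw [ff_succ C, ff_succ C _ y, min_comm]
  congr 1 <;> linarith

/-- turning points of level r -/
def EE (s : ℝ) (r : ℕ) : Set ℝ := {t | ff s r t = s ^ r / 2}

theorem EE_first {s δ : ℝ} (C : Ctx s δ) (r : ℕ) : s ^ r / 2 ∈ EE s r :=
  ff_id C (by have := C.bmono (show r ≤ r+1 by omega); linarith)

theorem EE_ge {s δ : ℝ} (C : Ctx s δ) {r : ℕ} {t : ℝ} (h : t ∈ EE s r) : s ^ r / 2 ≤ t := by
  have := ff_le_self C r (t := t)
  rw [EE, mem_ofPred_eq] at h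
  linarith

theorem EE_other {s δ : ℝ} (C : Ctx s δ) {r : ℕ} {t : ℝ} (h : t ∈ EE s r) (h2 : t ≠ s ^ r / 2) :
    s ^ (r + 1) / 2 < t := by
  by_contra hc
  push Not at hc
  rw [EE, mem_ofPred_eq, ff_id C hc] at h
  exact h2 h

theorem EE_far {s δ : ℝ} (C : Ctx s δ) {r i : ℕ} (hi : i < r) {z : ℝ} (hz : z ∈ EE s r) :
    δ * s ^ i ≤ |ff s i z - s ^ i / 2| := by
  obtain ⟨k, rfl⟩ := Nat.exists_eq_add_of_lt hi
  have hb := C.b0 i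
  have hbb := C.b0 (i + (k+1))
  rw [EE, mem_ofPred_eq, add_assoc] at hz
  rw [ff_iter C i (k+1), hz]
  have h := C.gap (k+1) (by omega)
  rw [show s ^ (i + (k + 1)) / 2 / s ^ (i + (k + 1)) = 1 / 2 by field_simp,
    show ∀ a : ℝ, s ^ i * a - s ^ i / 2 = s ^ i * (a - 1/2) by intro a; ring, abs_mul, abs_of_pos hb]
  nlinarith

theorem EE_far_dist {s δ : ℝ} (C : Ctx s δ) {r i : ℕ} (hi : i < r) {z y : ℝ} (hz : z ∈ EE s r)
    (hy : y ∈ EE s i) : δ * s ^ i ≤ |z - y| := by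
  have h1 := EE_far C hi hz
  have h2 := ff_lip C i z y
  rw [EE, mem_ofPred_eq] at hy
  rw [hy] at h2
  linarith

theorem EE_level {s δ : ℝ} (C : Ctx s δ) {r i : ℕ} {z : ℝ} (hz : z ∈ EE s r)
    (hy : z ∈ EE s i) : r = i := by
  have := C.b0 r
  have := C.b0 i
  have := C.hd0
  rcases lt_trichotomy r i with h | h | h
  · have := EE_far_dist C h hy hz; simp at this; nlinarith
  · exact h
  · have := EE_far_dist C h hz hy; simp at this; nlinarith

theorem affine_aux (f g : ℝ → ℝ) (x y b : ℝ) (hxy : x ≤ y)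
    (hg : ∀ z, g z = min (f z) (b - f z))
    (hno : ∀ z ∈ Ioo x y, f z ≠ b / 2)
    (hf : ∃ σ : ℝ, (σ = 1 ∨ σ = -1) ∧ ∀ z ∈ Icc x y, f z = f x + σ * (z - x)) :
    ∃ σ : ℝ, (σ = 1 ∨ σ = -1) ∧ ∀ z ∈ Icc x y, g z = g x + σ * (z - x) := by
  obtain ⟨σ, hσ, hf⟩ := hf
  have hx : x ∈ Icc x y := ⟨le_rfl, hxy⟩
  by_cases h1 : ∀ z ∈ Icc x y, f z ≤ b / 2
  · refine ⟨σ, hσ, fun z hz => ?_⟩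
    rw [hg, hg, min_eq_left (by linarith [h1 z hz]), min_eq_left (by linarith [h1 x hx]), hf z hz]
  · by_cases h2 : ∀ z ∈ Icc x y, b / 2 ≤ f z
    · refine ⟨-σ, by rcases hσ with h | h <;> simp [h], fun z hz => ?_⟩
      rw [hg, hg, min_eq_right (by linarith [h2 z hz]), min_eq_right (by linarith [h2 x hx]),
        hf z hz]
      ring
    · exfalso
      push Not at h1 h2
      obtain ⟨z1, hz1, hz1'⟩ := h1
      obtain ⟨z2, hz2, hz2'⟩ := h2
      rw [hf z1 hz1] at hz1'
      rw [hf z2 hz2] at hz2'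
      have hm : x + σ * (b / 2 - f x) ∈ Ioo x y := by
        rcases hσ with rfl | rfl
        · exact ⟨by linarith [hz2.1], by linarith [hz1.2]⟩
        · exact ⟨by linarith [hz1.1], by linarith [hz2.2]⟩
      refine hno _ hm ?_
      rw [hf _ (Ioo_subset_Icc_self hm)]
      rcases hσ with rfl | rfl <;> ring

theorem ff_affine {s δ : ℝ} (C : Ctx s δ) (p : ℕ) {x y : ℝ} (hxy : x ≤ y)
    (hno : ∀ i, p < i → ∀ z ∈ Ioo x y, z ∉ EE s i) :
    ∃ σ : ℝ, (σ = 1 ∨ σ = -1) ∧ ∀ z ∈ Icc x y, ff s p z = ff s p x + σ * (z - x) := by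
  refine down_ind C y (fun p => ∃ σ : ℝ, (σ = 1 ∨ σ = -1) ∧
    ∀ z ∈ Icc x y, ff s p z = ff s p x + σ * (z - x)) ?_ p ?_
  · intro r hr
    refine ⟨1, Or.inl rfl, fun z hz => ?_⟩
    rw [ff_id C (le_trans hz.2 hr), ff_id C (le_trans hxy hr)]
    ring
  · intro r hr h
    exact affine_aux (ff s (r+1)) (ff s r) x y (s ^ (r+1)) hxy (ff_succ C r)
      (fun z hz => hno (r+1) (by omega) z hz) h

theorem EE_gap {s δ : ℝ} (C : Ctx s δ) {p i j : ℕ} (hi : p ≤ i) (hj : p ≤ j) {x y : ℝ}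
    (hx : x ∈ EE s i) (hy : y ∈ EE s j) (hne : x ≠ y) : δ * s ^ p ≤ |x - y| := by
  have hd := C.hd0
  rcases lt_trichotomy i j with h | h | h
  · have := EE_far_dist C h hy hx
    rw [abs_sub_comm]
    nlinarith [C.bmono hi]
  · subst h
    wlog hxy : x < y generalizing x y
    · rw [abs_sub_comm]
      have h5 := lt_of_le_of_ne (not_lt.1 hxy) hne.symm
      apply this <;> first | assumption | exact hne.symm
    by_cases hno : ∀ l, i < l → ∀ z ∈ Ioo x y, z ∉ EE s l
    · exfalso
      obtain ⟨σ, hσ, hf⟩ := ff_affine C i hxy.le hno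
      have := hf y ⟨hxy.le, le_rfl⟩
      rw [EE, mem_ofPred_eq] at hx hy
      rw [hx, hy] at this
      rcases hσ with rfl | rfl <;> linarith
    · push Not at hno
      obtain ⟨l, hl, z, hz, hzl⟩ := hno
      have h2 := EE_far_dist C hl hzl hx
      rw [abs_of_pos (by linarith [hz.1])] at h2
      rw [abs_of_neg (by linarith [hz.1])]
      nlinarith [C.bmono hi, hz.2]
  · have := EE_far_dist C h hx hy
    nlinarith [C.bmono hj]

theorem EE_near {s δ : ℝ} (C : Ctx s δ) {r : ℕ} {x η : ℝ} (h : |ff s r x - s ^ r / 2| ≤ η)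
    (hη : 2 * η < δ * s ^ r) : ∃ z ∈ EE s r, |z - x| ≤ η := by
  have hη0 : 0 ≤ η := le_trans (abs_nonneg _) h
  have hno : ∀ i, r < i → ∀ z ∈ Ioo (x - η) (x + η), z ∉ EE s i := by
    intro i hi z hz hzi
    have h1 := EE_far C hi hzi
    have h2 := ff_lip C r z x
    have h3 : |z - x| ≤ η := by rw [abs_le]; exact ⟨by linarith [hz.1], by linarith [hz.2]⟩
    have h4 := abs_sub_le (ff s r z) (ff s r x) (s ^ r / 2)
    linarith
  obtain ⟨σ, hσ, hf⟩ := ff_affine C r (by linarith) hno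
  have hx := hf x ⟨by linarith, by linarith⟩
  rw [abs_le] at h
  rcases hσ with rfl | rfl
  · refine ⟨x + (s ^ r / 2 - ff s r x), ?_, ?_⟩
    · rw [EE, mem_ofPred_eq, hf _ ⟨by linarith, by linarith⟩]
      linarith
    · rw [abs_le]; exact ⟨by linarith, by linarith⟩
  · refine ⟨x - (s ^ r / 2 - ff s r x), ?_, ?_⟩
    · rw [EE, mem_ofPred_eq, hf _ ⟨by linarith, by linarith⟩]
      linarith
    · rw [abs_le]; exact ⟨by linarith, by linarith⟩

/-- affine behaviour of `ff r` near a point of `E_r` -/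
theorem EE_local {s δ : ℝ} (C : Ctx s δ) {r : ℕ} {z : ℝ} (hz : z ∈ EE s r) :
    ∃ σ : ℝ, (σ = 1 ∨ σ = -1) ∧ ∀ v, |v| ≤ δ * s ^ r → ff s r (z + v) = s ^ r / 2 + σ * v := by
  have hd := C.hd0
  have hb := C.b0 r
  have hno : ∀ i, r < i → ∀ y ∈ Ioo (z - δ * s ^ r) (z + δ * s ^ r), y ∉ EE s i := by
    intro i hi y hy hyi
    have h1 := EE_far_dist C hi hyi hz
    have h3 : |y - z| < δ * s ^ r := by rw [abs_lt]; exact ⟨by linarith [hy.1], by linarith [hy.2]⟩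
    linarith
  have hp : 0 < δ * s ^ r := by positivity
  obtain ⟨σ, hσ, hf⟩ := ff_affine C r (by linarith) hno
  refine ⟨σ, hσ, fun v hv => ?_⟩
  rw [abs_le] at hv
  have h0 := hf z ⟨by linarith, by linarith⟩
  rw [hf _ ⟨by linarith, by linarith⟩]
  rw [EE, mem_ofPred_eq] at hz
  rw [hz] at h0
  linarith

theorem EE_mirror {s δ : ℝ} (C : Ctx s δ) {r q : ℕ} (hq : q < r) {z v : ℝ} (hz : z ∈ EE s r)
    (hv : |v| ≤ δ * s ^ r) : ff s q (z + v) = ff s q (z - v) := by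
  obtain ⟨σ, hσ, hf⟩ := EE_local C hz
  refine ff_eq_of_sum C hq ?_
  rw [hf v hv, sub_eq_add_neg, hf (-v) (by rwa [abs_neg])]
  ring

theorem first_mirror {s δ : ℝ} (C : Ctx s δ) {r q : ℕ} (hq : q < r) {v : ℝ}
    (hv : |v| ≤ (s - 1) * (s ^ r / 2)) : ff s q (s ^ r / 2 + v) = ff s q (s ^ r / 2 - v) := by
  rw [abs_le] at hv
  refine ff_eq_of_sum C hq ?_
  rw [ff_id C (by rw [pow_succ]; nlinarith), ff_id C (by rw [pow_succ]; nlinarith)]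
  ring

theorem ff_tail {s δ : ℝ} (C : Ctx s δ) {n : ℕ} {t : ℝ} (h : s ^ (n + 1) / 2 ≤ t) :
    s ^ (n + 1) * (1 - s / 2) ≤ ff s n t := by
  refine (down_ind C t (fun m => n ≤ m → s ^ (n + 1) * (1 - s / 2) ≤ ff s m t) ?_ n ?_) le_rfl
  · intro r hr hn
    rw [ff_id C hr]
    have := C.b0 (n+1)
    nlinarith [C.h1]
  · intro r hr ih hn
    have h1 := ih (by omega)
    rw [ff_succ C]
    refine le_min h1 ?_
    have h2 := ff_le C (r+1) t
    have h3 := C.bmono (show n + 1 ≤ r + 1 by omega)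
    rw [pow_succ] at h2
    nlinarith [C.h2]

/-- fold of `ff 0` at a turning point of level at least one -/
theorem EE_fold {s δ : ℝ} (C : Ctx s δ) {r : ℕ} (hr : 1 ≤ r) {z : ℝ} (hz : z ∈ EE s r) :
    ∃ σ : ℝ, (σ = 1 ∨ σ = -1) ∧
      ∀ v, |v| ≤ δ / 2 → ff s 0 (z + v) = ff s 0 z + σ * |v| := by
  have hd := C.hd0
  have hno : ∀ i, 0 < i → ∀ y ∈ Ioo z (z + δ / 2), y ∉ EE s i := by
    intro i hi y hy hyi
    have h1 := EE_gap C (p := 0) (by omega) (by omega) hyi hz (by linarith [hy.1])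
    rw [abs_of_pos (by linarith [hy.1])] at h1
    simp at h1
    linarith [hy.2]
  obtain ⟨σ, hσ, hf⟩ := ff_affine C 0 (by linarith) hno
  refine ⟨σ, hσ, fun v hv => ?_⟩
  have key : ff s 0 (z + |v|) = ff s 0 z + σ * |v| := by
    rw [hf _ ⟨by linarith [abs_nonneg v], by linarith⟩]; ring
  rcases abs_cases v with ⟨h, _⟩ | ⟨h, _⟩
  · rw [h] at key ⊢; exact key
  · rw [← key, h, EE_mirror C (show 0 < r by omega) hz (v := v)]
    · congr 1
    · have := C.b1 r; nlinarith

theorem nat_first (P : ℕ → Prop) (hex : ∃ k, P k) : ∃ k, P k ∧ ∀ m, k = m + 1 → ¬ P m := by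
  classical
  exact ⟨Nat.find hex, Nat.find_spec hex, fun m hm => Nat.find_min hex (by omega)⟩

/-- all turning points of level at least one -/
def TP (s : ℝ) : Set ℝ := {z | ∃ r, 1 ≤ r ∧ z ∈ EE s r}

theorem TP_gap {s δ : ℝ} (C : Ctx s δ) {x y : ℝ} (hx : x ∈ TP s) (hy : y ∈ TP s) (h : x < y) :
    x + δ ≤ y := by
  obtain ⟨i, hi, hx⟩ := hx
  obtain ⟨j, hj, hy⟩ := hy
  have := EE_gap C (p := 0) (by omega) (by omega) hy hx h.ne'
  rw [abs_of_pos (by linarith)] at this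
  simp at this
  linarith

theorem TP_eq {s δ : ℝ} (C : Ctx s δ) {x y : ℝ} (hx : x ∈ TP s) (hy : y ∈ TP s)
    (h : |x - y| < δ) : x = y := by
  rw [abs_lt] at h
  rcases lt_trichotomy x y with h1 | h1 | h1
  · have := TP_gap C hx hy h1; linarith
  · exact h1
  · have := TP_gap C hy hx h1; linarith

/-- an increasing enumeration of the turning points -/
structure IsTau (s : ℝ) (τ : ℕ → ℝ) : Prop where
  zero : τ 0 = s / 2
  mono : StrictMono τ
  mem : ∀ k, τ k ∈ TP s
  surj : ∀ z ∈ TP s, ∃ k, z = τ k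

theorem TP_next {s δ : ℝ} (C : Ctx s δ) (x : ℝ) :
    ∃ y ∈ TP s, x < y ∧ ∀ z ∈ TP s, x < z → y ≤ z := by
  set S : Set ℝ := {z | z ∈ TP s ∧ x < z} with hS
  have hne : S.Nonempty := by
    obtain ⟨N, hN⟩ := C.big (2 * x)
    refine ⟨s ^ (N + 1) / 2, ⟨N+1, by omega, EE_first C _⟩, ?_⟩
    have := hN (N+1) (by omega)
    linarith
  have hbd : BddBelow S := ⟨x, fun z hz => hz.2.le⟩
  obtain ⟨y, hy, hy2⟩ := exists_lt_of_csInf_lt hne (show sInf S < sInf S + δ by linarith [C.hd0])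
  refine ⟨y, hy.1, hy.2, fun z hz hxz => ?_⟩
  by_contra hc
  push Not at hc
  have h1 := TP_gap C hz hy.1 hc
  have h2 : sInf S ≤ z := csInf_le hbd ⟨hz, hxz⟩
  linarith

theorem exists_tau {s δ : ℝ} (C : Ctx s δ) : ∃ τ, IsTau s τ := by
  choose nx h1 h2 h3 using TP_next C
  let τ : ℕ → ℝ := fun n => Nat.rec (s / 2) (fun _ p => nx p) n
  have hmono : StrictMono τ := strictMono_nat_of_lt_succ (fun n => h2 _)
  have hmem : ∀ k, τ k ∈ TP s := by
    intro k
    cases k with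
    | zero => exact ⟨1, le_rfl, by simpa [τ] using EE_first C 1⟩
    | succ k => exact h1 _
  refine ⟨τ, rfl, hmono, hmem, ?_⟩
  intro z hz
  have hlarge : ∀ k : ℕ, k * δ ≤ τ k := by
    intro k
    induction k with
    | zero => simp [τ]; linarith [C.s0]
    | succ k ih =>
      have := TP_gap C (hmem k) (hmem (k+1)) (hmono (Nat.lt_succ_self k))
      push_cast
      linarith
  have hex : ∃ k, z < τ k := by
    obtain ⟨k, hk⟩ := exists_nat_gt (z / δ)
    refine ⟨k, lt_of_lt_of_le ?_ (hlarge k)⟩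
    rwa [div_lt_iff₀ C.hd0] at hk
  obtain ⟨k, hf, hmin⟩ := nat_first _ hex
  rcases k with _ | m
  · exfalso
    obtain ⟨r, hr, hzr⟩ := hz
    have h5 := EE_ge C hzr
    have h6 := C.bmono hr
    have h7 : τ 0 = s / 2 := rfl
    rw [pow_one] at h6
    linarith
  · have h8 := hmin m rfl
    push Not at h8
    rcases h8.eq_or_lt with h9 | h9
    · exact ⟨m, h9.symm⟩
    · have : τ (m+1) ≤ z := h3 (τ m) z hz h9
      linarith

theorem IsTau.gap {s δ : ℝ} {τ : ℕ → ℝ} (T : IsTau s τ) (C : Ctx s δ) (k : ℕ) :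
    τ k + δ ≤ τ (k + 1) := TP_gap C (T.mem k) (T.mem _) (T.mono (by omega))

theorem IsTau.large {s δ : ℝ} {τ : ℕ → ℝ} (T : IsTau s τ) (C : Ctx s δ) (k : ℕ) : k * δ ≤ τ k := by
  induction k with
  | zero => rw [T.zero]; simp; linarith [C.s0]
  | succ k ih =>
    have := T.gap C k
    push_cast
    linarith

theorem IsTau.no {s : ℝ} {τ : ℕ → ℝ} (T : IsTau s τ) (k : ℕ) {z : ℝ}
    (hz : z ∈ Ioo (τ k) (τ (k+1))) : z ∉ TP s := by
  intro h
  obtain ⟨j, rfl⟩ := T.surj z h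
  have h1 := T.mono.lt_iff_lt.1 hz.1
  have h2 := T.mono.lt_iff_lt.1 hz.2
  omega

theorem IsTau.affine {s δ : ℝ} {τ : ℕ → ℝ} (T : IsTau s τ) (C : Ctx s δ) (k : ℕ) :
    ∃ σ : ℝ, (σ = 1 ∨ σ = -1) ∧ ∀ z ∈ Icc (τ k) (τ (k+1)),
      ff s 0 z = ff s 0 (τ k) + σ * (z - τ k) :=
  ff_affine C 0 (T.mono (by omega)).le (fun i hi z hz h => T.no k hz ⟨i, hi, h⟩)

/-- side of the k-th lap with respect to level r -/
def SS (s : ℝ) (τ : ℕ → ℝ) (r k : ℕ) : ℝ := ff s r ((τ k + τ (k + 1)) / 2) - s ^ r / 2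

theorem SS_ne {s : ℝ} {τ : ℕ → ℝ} (T : IsTau s τ) {r : ℕ} (hr : 1 ≤ r) (k : ℕ) :
    SS s τ r k ≠ 0 := by
  intro h
  have := T.mono (show k < k + 1 by omega)
  refine T.no k (z := (τ k + τ (k + 1)) / 2) ⟨by linarith, by linarith⟩ ⟨r, hr, ?_⟩
  rw [SS, sub_eq_zero] at h
  exact h

theorem SS_side {s δ : ℝ} {τ : ℕ → ℝ} (T : IsTau s τ) (C : Ctx s δ) {r : ℕ} (hr : 1 ≤ r) (k : ℕ)
    {z : ℝ} (hz : z ∈ Icc (τ k) (τ (k+1))) : 0 ≤ (ff s r z - s ^ r / 2) * SS s τ r k := by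
  by_contra hc
  push Not at hc
  have hlt := T.mono (show k < k + 1 by omega)
  set m := (τ k + τ (k + 1)) / 2 with hm
  have hb : s ^ r / 2 ∈ uIcc (ff s r z) (ff s r m) := by
    rw [SS, ← hm] at hc
    rw [mem_uIcc]
    rcases mul_neg_iff.1 hc with ⟨h1, h2⟩ | ⟨h1, h2⟩
    · right; constructor <;> linarith
    · left; constructor <;> linarith
  obtain ⟨w, hw, hw2⟩ := intermediate_value_uIcc (ff_cont C r).continuousOn hb
  have hwz : w ≠ z := by
    rintro rfl
    rw [hw2] at hc; simp at hc
  have : w ∈ Ioo (τ k) (τ (k+1)) := by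
    rw [mem_uIcc] at hw
    rcases hw with h | h
    · exact ⟨lt_of_le_of_lt hz.1 (lt_of_le_of_ne h.1 hwz.symm), by linarith⟩
    · exact ⟨by linarith, lt_of_lt_of_le (lt_of_le_of_ne h.2 hwz) hz.2⟩
  exact T.no k this ⟨r, hr, hw2⟩

theorem SS_same {s δ : ℝ} {τ : ℕ → ℝ} (T : IsTau s τ) (C : Ctx s δ) {r : ℕ} (hr : 1 ≤ r) (k : ℕ)
    (h : τ (k + 1) ∉ EE s r) : 0 < SS s τ r k * SS s τ r (k + 1) := by
  have hlt := T.mono (show k < k + 1 by omega)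
  have hlt2 := T.mono (show k + 1 < k + 1 + 1 by omega)
  have h1 := SS_side T C hr k (z := τ (k+1)) ⟨hlt.le, le_rfl⟩
  have h2 := SS_side T C hr (k+1) (z := τ (k+1)) ⟨le_rfl, hlt2.le⟩
  have h3 := SS_ne T hr k
  have h4 := SS_ne T hr (k+1)
  have h5 : ff s r (τ (k+1)) - s ^ r / 2 ≠ 0 := by
    intro h6; exact h (sub_eq_zero.1 h6)
  rcases lt_or_gt_of_ne h5 with h6 | h6
  · have a1 : SS s τ r k < 0 := lt_of_le_of_ne (by by_contra hh; push Not at hh; nlinarith) h3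
    have a2 : SS s τ r (k+1) < 0 := lt_of_le_of_ne (by by_contra hh; push Not at hh; nlinarith) h4
    exact mul_pos_of_neg_of_neg a1 a2
  · have a1 : 0 < SS s τ r k := lt_of_le_of_ne (by by_contra hh; push Not at hh; nlinarith) h3.symm
    have a2 : 0 < SS s τ r (k+1) :=
      lt_of_le_of_ne (by by_contra hh; push Not at hh; nlinarith) h4.symm
    exact mul_pos a1 a2

theorem SS_flip {s δ : ℝ} {τ : ℕ → ℝ} (T : IsTau s τ) (C : Ctx s δ) {r : ℕ} (hr : 1 ≤ r) (k : ℕ)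
    (h : τ (k + 1) ∈ EE s r) : SS s τ r k * SS s τ r (k + 1) < 0 := by
  have hd := C.hd0
  have hb := C.b1 r
  have hlt := T.gap C k
  have hlt2 := T.gap C (k+1)
  obtain ⟨σ, hσ, hf⟩ := EE_local C h
  have h1 := SS_side T C hr k (z := τ (k+1) + (-(δ/2))) ⟨by linarith, by linarith⟩
  have h2 := SS_side T C hr (k+1) (z := τ (k+1) + δ/2) ⟨by linarith, by linarith⟩
  rw [hf _ (by rw [abs_neg, abs_of_pos (by linarith)]; nlinarith)] at h1
  rw [hf _ (by rw [abs_of_pos (by linarith)]; nlinarith)] at h2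
  have h3 := SS_ne T hr k
  have h4 := SS_ne T hr (k+1)
  refine lt_of_le_of_ne ?_ (mul_ne_zero h3 h4)
  rcases hσ with rfl | rfl
  · have a1 : SS s τ r k ≤ 0 := by by_contra hh; push Not at hh; nlinarith
    have a2 : 0 ≤ SS s τ r (k+1) := by by_contra hh; push Not at hh; nlinarith
    nlinarith
  · have a1 : 0 ≤ SS s τ r k := by by_contra hh; push Not at hh; nlinarith
    have a2 : SS s τ r (k+1) ≤ 0 := by by_contra hh; push Not at hh; nlinarith
    nlinarith

/-- two points on the same side at all lower levels keep their distance -/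
theorem same_side {s δ : ℝ} (C : Ctx s δ) {n : ℕ} (hn : 1 ≤ n) {x y : ℝ}
    (h1 : ∀ r, 1 ≤ r → r < n → 0 ≤ (ff s r x - s ^ r / 2) * (ff s r y - s ^ r / 2))
    (h2 : (ff s n x - s ^ n / 2) * (ff s n y - s ^ n / 2) ≤ 0) :
    (∀ r, r < n → |ff s r x - ff s r y| = |ff s 0 x - ff s 0 y|) ∧
      |ff s n x + ff s n y - s ^ n| = |ff s 0 x - ff s 0 y| := by
  have A : ∀ r, r < n → |ff s r x - ff s r y| = |ff s 0 x - ff s 0 y| := by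
    intro r
    induction r with
    | zero => intro _; rfl
    | succ r ih =>
      intro hr
      rw [← ih (by omega)]
      have h := h1 (r+1) (by omega) hr
      rw [ff_succ C r x, ff_succ C r y]
      rcases le_total (ff s (r+1) x) (s^(r+1)/2) with hx | hx <;>
      rcases le_total (ff s (r+1) y) (s^(r+1)/2) with hy | hy
      · rw [min_eq_left (by linarith), min_eq_left (by linarith)]
      · rw [min_eq_left (by linarith), min_eq_right (by linarith)]
        have : ff s (r+1) x = s^(r+1)/2 ∨ ff s (r+1) y = s^(r+1)/2 := by
          by_contra hc
          push Not at hc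
          have q1 := lt_of_le_of_ne hx hc.1
          have q2 := lt_of_le_of_ne hy hc.2.symm
          nlinarith
        rcases this with h | h
        · rw [h, abs_sub_comm]; congr 1; ring
        · rw [h]; congr 1; ring
      · rw [min_eq_right (by linarith), min_eq_left (by linarith)]
        have : ff s (r+1) x = s^(r+1)/2 ∨ ff s (r+1) y = s^(r+1)/2 := by
          by_contra hc
          push Not at hc
          have q1 := lt_of_le_of_ne hx hc.1.symm
          have q2 := lt_of_le_of_ne hy hc.2
          nlinarith
        rcases this with h | h
        · rw [h]; congr 1; ring
        · rw [h, abs_sub_comm]; congr 1; ring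
      · rw [min_eq_right (by linarith), min_eq_right (by linarith), abs_sub_comm]; congr 1; ring
  refine ⟨A, ?_⟩
  obtain ⟨m, rfl⟩ : ∃ m, n = m + 1 := ⟨n - 1, by omega⟩
  rw [← A m (by omega), ff_succ C m x, ff_succ C m y]
  rcases le_total (ff s (m+1) x) (s^(m+1)/2) with hx | hx <;>
  rcases le_total (ff s (m+1) y) (s^(m+1)/2) with hy | hy
  · rw [min_eq_left (by linarith), min_eq_left (by linarith)]
    have : ff s (m+1) x = s^(m+1)/2 ∨ ff s (m+1) y = s^(m+1)/2 := by
      by_contra hc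
      push Not at hc
      have q1 := lt_of_le_of_ne hx hc.1
      have q2 := lt_of_le_of_ne hy hc.2
      nlinarith
    rcases this with h | h
    · rw [h, abs_sub_comm]; congr 1; ring
    · rw [h]; congr 1; ring
  · rw [min_eq_left (by linarith), min_eq_right (by linarith)]; congr 1; ring
  · rw [min_eq_right (by linarith), min_eq_left (by linarith), abs_sub_comm]; congr 1; ring
  · rw [min_eq_right (by linarith), min_eq_right (by linarith)]
    have : ff s (m+1) x = s^(m+1)/2 ∨ ff s (m+1) y = s^(m+1)/2 := by
      by_contra hc
      push Not at hc
      have q1 := lt_of_le_of_ne hx hc.1.symm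
      have q2 := lt_of_le_of_ne hy hc.2.symm
      nlinarith
    rcases this with h | h
    · rw [h]; congr 1; ring
    · rw [h, abs_sub_comm]; congr 1; ring

/-- hypotheses of the lifting lemma -/
structure LLH (s δ : ℝ) (τ : ℕ → ℝ) (g : ℝ ≃o ℝ) (t0 V ε : ℝ) (i n : ℕ) : Prop where
  he : 0 < ε
  he2 : 100 * ε ≤ δ
  hV : 0 ≤ V
  hn : 1 ≤ n
  hi : τ i ∈ EE s n
  base : |g t0 - τ i| ≤ ε
  close : ∀ v, 0 ≤ v → v ≤ V → |ff s 0 (g (t0 + v)) - ff s 0 (g (t0 - v))| ≤ ε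
  low : τ 0 + 20 * ε ≤ g (t0 - V)

/-- matched pair of turning points -/
def MM (τ : ℕ → ℝ) (g : ℝ ≃o ℝ) (t0 V ε : ℝ) (i k j : ℕ) (a : ℝ) : Prop :=
  i = j + 1 + k ∧ 0 ≤ a ∧ a ≤ V ∧ |g (t0 + a) - τ (i + k)| ≤ ε ∧ |g (t0 - a) - τ (j + 1)| ≤ 9 * ε

theorem clamp_lap {s δ : ℝ} {τ : ℕ → ℝ} (T : IsTau s τ) (C : Ctx s δ) (k : ℕ) {η : ℝ} (hη : 0 ≤ η) :
    ∃ σ : ℝ, (σ = 1 ∨ σ = -1) ∧ ∀ u, τ k - η ≤ u → u ≤ τ (k+1) + η →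
      |ff s 0 u - (ff s 0 (τ k) + σ * (max (τ k) (min u (τ (k+1))) - τ k))| ≤ η := by
  obtain ⟨σ, hσ, hf⟩ := T.affine C k
  refine ⟨σ, hσ, fun u h1 h2 => ?_⟩
  have hlt := T.mono (show k < k + 1 by omega)
  set c := max (τ k) (min u (τ (k+1))) with hc
  have hc1 : τ k ≤ c := le_max_left _ _
  have hc2 : c ≤ τ (k+1) := max_le hlt.le (min_le_right _ _)
  rw [← hf c ⟨hc1, hc2⟩]
  refine le_trans (ff_lip C 0 _ _) ?_
  rw [abs_le]
  constructor
  · have : c ≤ u + η := max_le (by linarith) (le_trans (min_le_left _ _) (by linarith))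
    linarith
  · have : u - η ≤ c := le_trans (le_min (by linarith) (by linarith)) (le_max_right _ _)
    linarith

theorem clamp_mono (x X : ℝ) {u u' : ℝ} (h : u ≤ u') : max x (min u X) ≤ max x (min u' X) :=
  max_le_max le_rfl (min_le_min h le_rfl)

theorem TP_fold {s δ : ℝ} (C : Ctx s δ) {z : ℝ} (hz : z ∈ TP s) :
    ∃ σ : ℝ, (σ = 1 ∨ σ = -1) ∧
      ∀ v, |v| ≤ δ / 2 → ff s 0 (z + v) = ff s 0 z + σ * |v| := by
  obtain ⟨r, hr, hz⟩ := hz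
  exact EE_fold C hr hz

theorem LLH.mem_w {s δ : ℝ} {τ : ℕ → ℝ} {g : ℝ ≃o ℝ} {t0 V ε : ℝ} {i n : ℕ}
    (L : LLH s δ τ g t0 V ε i n) {y v : ℝ} (h1 : g (t0 - v) ≤ y) (a : ℝ) (h2 : y ≤ g (t0 - a)) :
    ∃ b, a ≤ b ∧ b ≤ v ∧ g (t0 - b) = y := by
  refine ⟨t0 - g.symm y, ?_, ?_, ?_⟩
  · have := (g.symm_apply_le).2 h2; linarith
  · have := (g.le_symm_apply).2 h1; linarith
  · rw [sub_sub_cancel, g.apply_symm_apply]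

theorem LLH.mem_u {s δ : ℝ} {τ : ℕ → ℝ} {g : ℝ ≃o ℝ} {t0 V ε : ℝ} {i n : ℕ}
    (L : LLH s δ τ g t0 V ε i n) {y v : ℝ} (h1 : y ≤ g (t0 + v)) (a : ℝ) (h2 : g (t0 + a) ≤ y) :
    ∃ b, a ≤ b ∧ b ≤ v ∧ g (t0 + b) = y := by
  refine ⟨g.symm y - t0, ?_, ?_, ?_⟩
  · have := (g.le_symm_apply).2 h2; linarith
  · have := (g.symm_apply_le).2 h1; linarith
  · rw [add_sub_cancel, g.apply_symm_apply]

theorem LL_lower {s δ : ℝ} {τ : ℕ → ℝ} {g : ℝ ≃o ℝ} {t0 V ε : ℝ} {i n : ℕ}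
    (T : IsTau s τ) (C : Ctx s δ) (L : LLH s δ τ g t0 V ε i n) {k j : ℕ} {a v : ℝ}
    (M : MM τ g t0 V ε i k j a) (hav : a ≤ v) (hvV : v ≤ V)
    (hu : g (t0 + v) ≤ τ (i + k + 1) + 3 * ε) : τ j - 9 * ε ≤ g (t0 - v) := by
  by_contra hc
  push Not at hc
  obtain ⟨hij, ha0, haV, hMu, hMw⟩ := M
  have he := L.he
  have he2 := L.he2
  have hg := T.gap C j
  rw [abs_le] at hMu hMw
  obtain ⟨d, had, hdv, hd⟩ := L.mem_w (y := τ j + 9 * ε) (v := v) (by linarith) a (by linarith)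
  obtain ⟨e, hde, hev, hee⟩ := L.mem_w (y := τ j) (v := v) (by linarith) d (by linarith)
  obtain ⟨b, heb, hbv, hb⟩ := L.mem_w (y := τ j + -(9 * ε)) (v := v) (by linarith) e (by linarith)
  obtain ⟨σ', hσ', hf'⟩ := TP_fold C (T.mem j)
  have f1 := hf' (9 * ε) (by rw [abs_of_pos (by linarith)]; linarith)
  have f2 := hf' (-(9 * ε)) (by rw [abs_neg, abs_of_pos (by linarith)]; linarith)
  rw [abs_neg, abs_of_pos (by linarith)] at f2
  rw [abs_of_pos (by linarith)] at f1
  obtain ⟨σ, hσ, hf⟩ := clamp_lap T C (i + k) (η := 3 * ε) (by linarith)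
  have ma : g (t0 + a) ≤ g (t0 + d) := g.monotone (by linarith)
  have m1 : g (t0 + d) ≤ g (t0 + e) := g.monotone (by linarith)
  have m2 : g (t0 + e) ≤ g (t0 + b) := g.monotone (by linarith)
  have m3 : g (t0 + b) ≤ g (t0 + v) := g.monotone (by linarith)
  have c1 := hf (g (t0 + d)) (by linarith) (by linarith)
  have c2 := hf (g (t0 + e)) (by linarith) (by linarith)
  have c3 := hf (g (t0 + b)) (by linarith) (by linarith)
  have k1 := L.close d (by linarith) (by linarith)
  have k2 := L.close e (by linarith) (by linarith)
  have k3 := L.close b (by linarith) (by linarith)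
  rw [hd, f1] at k1
  rw [hee] at k2
  rw [hb, f2] at k3
  have n1 := clamp_mono (τ (i + k)) (τ (i + k + 1)) m1
  have n2 := clamp_mono (τ (i + k)) (τ (i + k + 1)) m2
  rw [abs_le] at c1 c2 c3 k1 k2 k3
  rcases hσ with rfl | rfl <;> rcases hσ' with rfl | rfl <;> linarith

theorem LL_match {s δ : ℝ} {τ : ℕ → ℝ} {g : ℝ ≃o ℝ} {t0 V ε : ℝ} {i n : ℕ}
    (T : IsTau s τ) (C : Ctx s δ) (L : LLH s δ τ g t0 V ε i n) {k j : ℕ} {a : ℝ}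
    (M : MM τ g t0 V ε i k j a) (hu : τ (i + k + 1) + 3 * ε ≤ g (t0 + V)) :
    ∃ A, 0 ≤ A ∧ A ≤ V ∧ g (t0 + A) = τ (i + k + 1) ∧ |g (t0 - A) - τ j| ≤ 9 * ε := by
  have M' := M
  obtain ⟨hij, ha0, haV, hMu, hMw⟩ := M'
  have he := L.he
  have he2 := L.he2
  have hg := T.gap C j
  have hg2 := T.gap C (i + k)
  rw [abs_le] at hMu hMw
  set X := τ (i + k + 1) with hX
  obtain ⟨m, ham, hmV, hm⟩ := L.mem_u (y := X + -(3 * ε)) (v := V) (by linarith) a (by linarith)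
  obtain ⟨A, hmA, hAV, hA⟩ := L.mem_u (y := X) (v := V) (by linarith) m (by linarith)
  obtain ⟨p, hAp, hpV, hp⟩ := L.mem_u (y := X + 3 * ε) (v := V) (by linarith) A (by linarith)
  refine ⟨A, by linarith, hAV, hA, ?_⟩
  have low := LL_lower T C L M (by linarith) hAV (by rw [hA]; linarith)
  rw [abs_le]
  refine ⟨by linarith, ?_⟩
  by_contra hc
  have hc' : τ j + 9 * ε < g (t0 - A) := by linarith
  have w1 : g (t0 - m) ≤ g (t0 - a) := g.monotone (by linarith)
  have w2 : g (t0 - A) ≤ g (t0 - m) := g.monotone (by linarith)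
  have w3 : g (t0 - p) ≤ g (t0 - A) := g.monotone (by linarith)
  obtain ⟨σ1, hσ1, hf1⟩ := T.affine C (i + k)
  rw [← hX] at hf1
  have k0 := L.close a (by linarith) (by linarith)
  have k1 := L.close m (by linarith) (by linarith)
  have k2 := L.close A (by linarith) (by linarith)
  have k3 := L.close p (by linarith) (by linarith)
  have lip := ff_lip C 0
  -- the left point has entered the left lap
  have hm1 : g (t0 - m) ≤ τ (j + 1) := by
    by_contra hh
    push Not at hh
    have e1 := lip (g (t0 - m)) (g (t0 - a))
    rw [abs_of_nonpos (show g (t0 - m) - g (t0 - a) ≤ 0 by linarith)] at e1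
    have e2 := hf1 (g (t0 + m)) ⟨by linarith, by linarith⟩
    have e3 := lip (g (t0 + a)) (τ (i + k))
    have e4 : |g (t0 + a) - τ (i + k)| ≤ ε := by rw [abs_le]; exact hMu
    rw [hm] at e2 k1
    rw [e2] at k1
    have e5 := le_trans e3 e4
    rw [abs_le] at k0 k1 e1 e5
    rcases hσ1 with rfl | rfl <;> linarith
  obtain ⟨σ, hσ, hf⟩ := TP_fold C (T.mem (i + k + 1))
  rw [← hX] at hf
  have f1 := hf (3 * ε) (by rw [abs_of_pos (by linarith)]; linarith)
  have f2 := hf (-(3 * ε)) (by rw [abs_neg, abs_of_pos (by linarith)]; linarith)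
  rw [abs_neg, abs_of_pos (by linarith)] at f2
  rw [abs_of_pos (by linarith)] at f1
  obtain ⟨σ', hσ', hf'⟩ := T.affine C j
  have q1 := hf' (g (t0 - m)) ⟨by linarith, by linarith⟩
  have q2 := hf' (g (t0 - A)) ⟨by linarith, by linarith⟩
  by_cases hpj : τ j ≤ g (t0 - p)
  · have q3 := hf' (g (t0 - p)) ⟨by linarith, by linarith⟩
    rw [hm, f2, q1] at k1
    rw [hA, q2] at k2
    rw [hp, f1, q3] at k3
    rw [abs_le] at k1 k2 k3
    rcases hσ with rfl | rfl <;> rcases hσ' with rfl | rfl <;> linarith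
  · push Not at hpj
    obtain ⟨q, hAq, hqp, hq⟩ := L.mem_w (y := τ j) (v := p) (by linarith) A (by linarith)
    have k4 := L.close q (by linarith) (by linarith)
    have z1 : g (t0 + A) ≤ g (t0 + q) := g.monotone (by linarith)
    have z2 : g (t0 + q) ≤ g (t0 + p) := g.monotone (by linarith)
    have z3 := lip (g (t0 + q)) (g (t0 + A))
    rw [abs_of_nonneg (show 0 ≤ g (t0 + q) - g (t0 + A) by linarith)] at z3
    rw [hq] at k4
    rw [q2] at k2
    rw [abs_le] at k2 k4 z3
    rcases hσ' with rfl | rfl <;> linarith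

theorem LL_M {s δ : ℝ} {τ : ℕ → ℝ} {g : ℝ ≃o ℝ} {t0 V ε : ℝ} {i n : ℕ}
    (T : IsTau s τ) (C : Ctx s δ) (L : LLH s δ τ g t0 V ε i n) (k : ℕ)
    (hk : k = 0 ∨ τ (i + k) + 3 * ε ≤ g (t0 + V)) :
    ∃ j a, MM τ g t0 V ε i k j a ∧ (k = 0 → a = 0) := by
  have he := L.he
  have he2 := L.he2
  have hlow := L.low
  induction k with
  | zero =>
    have hb := L.base
    have h1 : g (t0 - V) ≤ g t0 := g.monotone (by linarith [L.hV])
    have hi0 : i ≠ 0 := by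
      rintro rfl
      rw [abs_le] at hb
      linarith
    obtain ⟨j, rfl⟩ := Nat.exists_eq_succ_of_ne_zero hi0
    refine ⟨j, 0, ⟨rfl, le_rfl, L.hV, ?_, ?_⟩, fun _ => rfl⟩
    · simpa using hb
    · rw [sub_zero]; exact le_trans hb (by linarith)
  | succ k ih =>
    have hk' : τ (i + k + 1) + 3 * ε ≤ g (t0 + V) := by
      rcases hk with h | h
      · omega
      · exact h
    have h2 : τ (i + k) ≤ τ (i + k + 1) := (T.mono (by omega)).le
    obtain ⟨j, a, M, -⟩ := ih (Or.inr (by linarith))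
    obtain ⟨A, hA0, hAV, hAu, hAw⟩ := LL_match T C L M hk'
    have h1 : g (t0 - V) ≤ g (t0 - A) := g.monotone (by linarith)
    have hj0 : j ≠ 0 := by
      rintro rfl
      rw [abs_le] at hAw
      linarith
    obtain ⟨j, rfl⟩ := Nat.exists_eq_succ_of_ne_zero hj0
    refine ⟨j, A, ⟨?_, hA0, hAV, ?_, hAw⟩, fun h => by omega⟩
    · have := M.1; omega
    · rw [← add_assoc, hAu]; simp; linarith

theorem pos_of_three {a b c d : ℝ} (h1 : 0 < a * b) (h2 : 0 < c * d) (h3 : 0 < a * c) :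
    0 < b * d := by
  have : 0 < (a * c) * (b * d) := by nlinarith [mul_pos h1 h2]
  exact (mul_pos_iff_of_pos_left h3).1 this

theorem side_mul {a b p q : ℝ} (h1 : 0 ≤ a * p) (h2 : 0 ≤ b * q) (h : 0 < p * q) : 0 ≤ a * b := by
  by_contra hc
  push Not at hc
  have : (a * b) * (p * q) < 0 := mul_neg_of_neg_of_pos hc h
  nlinarith [mul_nonneg h1 h2]

theorem side_mul' {a b p q : ℝ} (h1 : 0 ≤ a * p) (h2 : 0 ≤ b * q) (h : p * q < 0) : a * b ≤ 0 := by
  by_contra hc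
  push Not at hc
  have : (a * b) * (p * q) < 0 := mul_neg_of_pos_of_neg hc h
  nlinarith [mul_nonneg h1 h2]

/-- sides of matched laps -/
def Sig (s : ℝ) (τ : ℕ → ℝ) (n p j : ℕ) : Prop :=
  (∀ r, 1 ≤ r → r < n → 0 < SS s τ r p * SS s τ r j) ∧ SS s τ n p * SS s τ n j < 0

theorem Sig_E1 {s δ : ℝ} {τ : ℕ → ℝ} (T : IsTau s τ) (C : Ctx s δ) {n p j : ℕ} (hn : 1 ≤ n)
    (S : Sig s τ n p j) {x y : ℝ} (hx : x ∈ Icc (τ p) (τ (p+1))) (hy : y ∈ Icc (τ j) (τ (j+1))) :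
    (∀ r, r < n → |ff s r x - ff s r y| = |ff s 0 x - ff s 0 y|) ∧
      |ff s n x + ff s n y - s ^ n| = |ff s 0 x - ff s 0 y| :=
  same_side C hn
    (fun r hr hrn => side_mul (SS_side T C hr p hx) (SS_side T C hr j hy) (S.1 r hr hrn))
    (side_mul' (SS_side T C hn p hx) (SS_side T C hn j hy) S.2)

theorem near_eq {s δ : ℝ} (C : Ctx s δ) {r : ℕ} (hr : 1 ≤ r) {z η : ℝ} (hz : z ∈ TP s)
    (h : |ff s r z - s ^ r / 2| ≤ η) (hη : 2 * η < δ) : z ∈ EE s r := by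
  have hd := C.hd0
  have hb := C.b1 r
  have h0 := le_trans (abs_nonneg _) h
  obtain ⟨y, hy, hyz⟩ := EE_near C h (by nlinarith)
  have := TP_eq C ⟨r, hr, hy⟩ hz (by linarith)
  rwa [← this]

theorem LL_Sig {s δ : ℝ} {τ : ℕ → ℝ} {g : ℝ ≃o ℝ} {t0 V ε : ℝ} {i n : ℕ}
    (T : IsTau s τ) (C : Ctx s δ) (L : LLH s δ τ g t0 V ε i n) (k : ℕ)
    (hk : k = 0 ∨ τ (i + k) + 3 * ε ≤ g (t0 + V)) (j : ℕ) (hj : i = j + 1 + k) :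
    Sig s τ n (i + k) j := by
  have he := L.he
  have he2 := L.he2
  have hn := L.hn
  induction k generalizing j with
  | zero =>
    have hij : i = j + 1 := hj
    have hi := L.hi
    subst hij
    refine ⟨fun r hr hrn => ?_, ?_⟩
    · rw [mul_comm]
      refine SS_same T C hr j (fun h => ?_)
      have := EE_level C h hi
      omega
    · rw [mul_comm]
      exact SS_flip T C hn j hi
  | succ k ih =>
    have hk' : τ (i + k + 1) + 3 * ε ≤ g (t0 + V) := by
      rcases hk with h | h
      · omega
      · exact h
    have h2 : τ (i + k) ≤ τ (i + k + 1) := (T.mono (by omega)).le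
    have S := ih (Or.inr (by linarith)) (j + 1) (by omega)
    obtain ⟨j', a, M, -⟩ := LL_M T C L (k+1) hk
    obtain ⟨hij, ha0, haV, hMu, hMw⟩ := M
    have hjj : j' = j := by omega
    subst hjj
    have hcl := L.close a ha0 haV
    have l1 := le_trans (ff_lip C 0 _ _) hMu
    have l2 := le_trans (ff_lip C 0 _ _) hMw
    have hRL : |ff s 0 (τ (i + k + 1)) - ff s 0 (τ (j' + 1))| ≤ 11 * ε := by
      rw [← add_assoc] at l1
      rw [abs_le] at *
      constructor <;> linarith
    have E := Sig_E1 T C hn S (x := τ (i + k + 1)) (y := τ (j' + 1)) ⟨h2, le_rfl⟩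
      ⟨le_rfl, (T.mono (by omega)).le⟩
    have hiff : ∀ r, 1 ≤ r → r ≤ n → (τ (i + k + 1) ∈ EE s r ↔ τ (j' + 1) ∈ EE s r) := by
      intro r hr hrn
      rcases hrn.lt_or_eq with hlt | rfl
      · have e := E.1 r hlt
        constructor
        · intro hh
          refine near_eq C hr (T.mem _) (η := 11 * ε) ?_ (by linarith)
          rw [← hh, abs_sub_comm, e]; exact hRL
        · intro hh
          refine near_eq C hr (T.mem _) (η := 11 * ε) ?_ (by linarith)
          rw [← hh, e]; exact hRL
      · have e := E.2
        constructor
        · intro hh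
          refine near_eq C hr (T.mem _) (η := 11 * ε) ?_ (by linarith)
          rw [EE, mem_ofPred_eq] at hh
          rw [hh] at e
          rw [← e] at hRL
          convert hRL using 2
          ring
        · intro hh
          refine near_eq C hr (T.mem _) (η := 11 * ε) ?_ (by linarith)
          rw [EE, mem_ofPred_eq] at hh
          rw [hh] at e
          rw [← e] at hRL
          convert hRL using 2
          ring
    have key : ∀ r, 1 ≤ r → r ≤ n → 0 < (SS s τ r (i + k) * SS s τ r (j' + 1)) *
        (SS s τ r (i + k + 1) * SS s τ r j') := by
      intro r hr hrn
      by_cases hm : τ (i + k + 1) ∈ EE s r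
      · have q1 := SS_flip T C hr (i + k) hm
        have q2 := SS_flip T C hr j' ((hiff r hr hrn).1 hm)
        have := mul_pos_of_neg_of_neg q1 q2
        linarith
      · have q1 := SS_same T C hr (i + k) hm
        have q2 := SS_same T C hr j' (fun h => hm ((hiff r hr hrn).2 h))
        have := mul_pos q1 q2
        linarith
    refine ⟨fun r hr hrn => ?_, ?_⟩
    · exact (mul_pos_iff_of_pos_left (S.1 r hr hrn)).1 (key r hr hrn.le)
    · have h3 := key n hn le_rfl
      by_contra hc
      push Not at hc
      have := mul_nonpos_of_nonpos_of_nonneg S.2.le hc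
      rw [← add_assoc] at this
      linarith

/-- the lifting lemma -/
theorem LL {s δ : ℝ} {τ : ℕ → ℝ} {g : ℝ ≃o ℝ} {t0 V ε : ℝ} {i n : ℕ}
    (T : IsTau s τ) (C : Ctx s δ) (L : LLH s δ τ g t0 V ε i n) {v : ℝ} (hv0 : 0 ≤ v) (hvV : v ≤ V) :
    (∀ r, r < n → |ff s r (g (t0 + v)) - ff s r (g (t0 - v))| ≤ 25 * ε) ∧
      |ff s n (g (t0 + v)) + ff s n (g (t0 - v)) - s ^ n| ≤ 25 * ε := by
  have he := L.he
  have he2 := L.he2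
  have hn := L.hn
  have hex : ∃ k : ℕ, g (t0 + v) < τ (i + k + 1) + 3 * ε := by
    obtain ⟨k, hk⟩ := exists_nat_gt (g (t0 + v) / δ)
    refine ⟨k, ?_⟩
    rw [div_lt_iff₀ C.hd0] at hk
    have h1 := T.large C k
    have h2 : τ k ≤ τ (i + k + 1) := (T.mono (by omega)).le
    linarith
  classical
  obtain ⟨k, hk1, hk2⟩ : ∃ k : ℕ, (k = 0 ∨ τ (i + k) + 3 * ε ≤ g (t0 + v)) ∧
      g (t0 + v) < τ (i + k + 1) + 3 * ε := by
    refine ⟨Nat.find hex, ?_, Nat.find_spec hex⟩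
    rcases hk : Nat.find hex with _ | m
    · left; rfl
    · right
      have := Nat.find_min hex (m := m) (by omega)
      push Not at this
      exact this
  have hvV' : g (t0 + v) ≤ g (t0 + V) := g.monotone (by linarith)
  have hk3 : k = 0 ∨ τ (i + k) + 3 * ε ≤ g (t0 + V) := hk1.imp id (fun h => by linarith)
  obtain ⟨j, a, M, ha⟩ := LL_M T C L k hk3
  have S := LL_Sig T C L k hk3 j M.1
  have M' := M
  obtain ⟨hij, ha0, haV, hMu, hMw⟩ := M'
  rw [abs_le] at hMu hMw
  have hav : a ≤ v := by
    rcases hk1 with h | h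
    · rw [ha h]; exact hv0
    · by_contra hc
      push Not at hc
      have : g (t0 + v) ≤ g (t0 + a) := g.monotone (by linarith)
      linarith
  have lo := LL_lower T C L M hav hvV hk2.le
  have u1 : g (t0 + a) ≤ g (t0 + v) := g.monotone (by linarith)
  have w1 : g (t0 - v) ≤ g (t0 - a) := g.monotone (by linarith)
  have o1 : τ (i + k) ≤ τ (i + k + 1) := (T.mono (by omega)).le
  have o2 : τ j ≤ τ (j + 1) := (T.mono (by omega)).le
  set u := g (t0 + v) with hu
  set w := g (t0 - v) with hw
  obtain ⟨x, hx, hxu⟩ : ∃ x ∈ Icc (τ (i + k)) (τ (i + k + 1)), |x - u| ≤ 3 * ε := by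
    refine ⟨max (τ (i + k)) (min u (τ (i+k+1))), ⟨le_max_left _ _, max_le o1 (min_le_right _ _)⟩, ?_⟩
    rw [abs_le]
    constructor
    · have : u - 3 * ε ≤ max (τ (i + k)) (min u (τ (i+k+1))) :=
        le_trans (le_min (by linarith) (by linarith)) (le_max_right _ _)
      linarith
    · have : max (τ (i + k)) (min u (τ (i+k+1))) ≤ u + 3 * ε :=
        max_le (by linarith) (le_trans (min_le_left _ _) (by linarith))
      linarith
  obtain ⟨y, hy, hyw⟩ : ∃ y ∈ Icc (τ j) (τ (j + 1)), |y - w| ≤ 9 * ε := by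
    refine ⟨max (τ j) (min w (τ (j+1))), ⟨le_max_left _ _, max_le o2 (min_le_right _ _)⟩, ?_⟩
    rw [abs_le]
    constructor
    · have : w - 9 * ε ≤ max (τ j) (min w (τ (j+1))) :=
        le_trans (le_min (by linarith) (by linarith)) (le_max_right _ _)
      linarith
    · have : max (τ j) (min w (τ (j+1))) ≤ w + 9 * ε :=
        max_le (by linarith) (le_trans (min_le_left _ _) (by linarith))
      linarith
  have E := Sig_E1 T C hn S hx hy
  have lx : ∀ r, |ff s r x - ff s r u| ≤ 3 * ε := fun r => le_trans (ff_lip C r _ _) hxu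
  have ly : ∀ r, |ff s r y - ff s r w| ≤ 9 * ε := fun r => le_trans (ff_lip C r _ _) hyw
  have hcl := L.close v hv0 hvV
  rw [← hu, ← hw] at hcl
  have h0 : |ff s 0 x - ff s 0 y| ≤ 13 * ε := by
    have a1 := lx 0
    have a2 := ly 0
    rw [abs_le] at *
    constructor <;> linarith
  refine ⟨fun r hr => ?_, ?_⟩
  · have a1 := lx r
    have a2 := ly r
    have a3 := E.1 r hr
    rw [← a3] at h0
    rw [abs_le] at h0 a1 a2 ⊢
    constructor <;> linarith
  · have a1 := lx n
    have a2 := ly n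
    have a3 := E.2
    rw [← a3] at h0
    rw [abs_le] at h0 a1 a2 ⊢
    constructor <;> linarith

/-- uniform continuity of the induced ray map -/
structure GU (s : ℝ) (g : ℝ ≃o ℝ) : Prop where
  zero : g 0 = 0
  uc : ∀ (p : ℕ) (ε : ℝ), 0 < ε → ∃ q : ℕ, ∃ κ : ℝ, 0 < κ ∧ ∀ t t', 0 ≤ t → 0 ≤ t' →
    |ff s q t - ff s q t'| ≤ κ → |ff s p (g t) - ff s p (g t')| ≤ ε

theorem GU.nonneg {s : ℝ} {g : ℝ ≃o ℝ} (G : GU s g) {t : ℝ} (h : 0 ≤ t) : 0 ≤ g t := by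
  rw [← G.zero]; exact g.monotone h

/-- uniform continuity with respect to the ray parameter -/
theorem GU.lu {s δ : ℝ} {g : ℝ ≃o ℝ} (C : Ctx s δ) (G : GU s g) {η : ℝ} (hη : 0 < η) :
    ∃ κ : ℝ, 0 < κ ∧ ∀ t t', 0 ≤ t → 0 ≤ t' → |t - t'| ≤ κ → |g t - g t'| ≤ η := by
  have hd := C.hd0
  wlog hη2 : η ≤ δ / 2 generalizing η
  · obtain ⟨κ, hκ, h⟩ := this (η := δ / 2) (by linarith) le_rfl
    exact ⟨κ, hκ, fun t t' h1 h2 h3 => le_trans (h t t' h1 h2 h3) (by linarith)⟩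
  obtain ⟨q, κ, hκ, h⟩ := G.uc 0 (η / 4) (by linarith)
  refine ⟨κ, hκ, ?_⟩
  have key : ∀ t t', 0 ≤ t → t ≤ t' → t' - t ≤ κ → g t' - g t ≤ η := by
    intro t t' ht htt' hk
    by_contra hc
    push Not at hc
    have small : ∀ y y', g t ≤ y → y ≤ g t' → g t ≤ y' → y' ≤ g t' →
        |ff s 0 y - ff s 0 y'| ≤ η / 4 := by
      intro y y' a1 a2 a3 a4
      have b1 := g.le_symm_apply.2 a1
      have b2 := g.symm_apply_le.2 a2
      have b3 := g.le_symm_apply.2 a3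
      have b4 := g.symm_apply_le.2 a4
      have := h (g.symm y) (g.symm y') (by linarith) (by linarith) (by
        refine le_trans (ff_lip C q _ _) ?_
        rw [abs_le]; constructor <;> linarith)
      simpa using this
    have clean : ∃ a, g t ≤ a ∧ a + η / 2 ≤ g t' ∧ ∀ z ∈ Ioo a (a + η / 2), z ∉ TP s := by
      by_cases hz : ∃ z ∈ Ioo (g t) (g t + η / 2), z ∈ TP s
      · obtain ⟨z, hz1, hz2⟩ := hz
        refine ⟨g t + η / 2, by linarith, by linarith, fun y hy hyT => ?_⟩
        have := TP_gap C hz2 hyT (by linarith [hz1.2, hy.1])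
        linarith [hz1.1, hy.2]
      · push Not at hz
        exact ⟨g t, le_rfl, by linarith, hz⟩
    obtain ⟨a, ha1, ha2, ha3⟩ := clean
    obtain ⟨σ, hσ, hf⟩ := ff_affine C 0 (x := a) (y := a + η / 2) (by linarith)
      (fun i hi z hz hzi => ha3 z hz ⟨i, hi, hzi⟩)
    have h1 := small (a + η / 2) a (by linarith) (by linarith) (by linarith) (by linarith)
    rw [hf _ ⟨by linarith, le_rfl⟩, abs_le] at h1
    rcases hσ with rfl | rfl <;> linarith
  intro t t' ht ht' hk
  rw [abs_le] at hk ⊢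
  rcases le_total t t' with hle | hle
  · have := key t t' ht hle (by linarith)
    have := g.monotone hle
    constructor <;> linarith
  · have := key t' t ht' hle (by linarith)
    have := g.monotone hle
    constructor <;> linarith

theorem GU.coarse {s δ : ℝ} {g : ℝ ≃o ℝ} (C : Ctx s δ) (G : GU s g) :
    ∃ κ : ℝ, 0 < κ ∧ ∀ t, 0 ≤ t → g t ≤ t / κ + 1 := by
  obtain ⟨κ, hκ, h⟩ := G.lu C (η := 1) one_pos
  refine ⟨κ, hκ, ?_⟩
  have step : ∀ n : ℕ, g (n * κ) ≤ n := by
    intro n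
    induction n with
    | zero => simp [G.zero]
    | succ n ih =>
      have := h ((n + 1 : ℕ) * κ) (n * κ) (by positivity) (by positivity) (by
        push_cast
        rw [abs_le]; constructor <;> linarith)
      rw [abs_le] at this
      push_cast at this ⊢
      linarith
  intro t ht
  have h1 := Nat.le_ceil (t / κ)
  have h2 := Nat.ceil_lt_add_one (show 0 ≤ t / κ by positivity)
  have h3 : t ≤ ⌈t / κ⌉₊ * κ := by rwa [div_le_iff₀ hκ] at h1
  have := g.monotone h3
  have := step ⌈t / κ⌉₊
  linarith

/-- images of turning points of high level are near turning points of high level -/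
theorem GU.near {s δ : ℝ} {g : ℝ ≃o ℝ} (C : Ctx s δ) (G : GU s g) (G' : GU s g.symm)
    (p : ℕ) {ε : ℝ} (hε : 0 < ε) :
    ∃ q : ℕ, ∀ r, q ≤ r → ∀ t ∈ EE s r, ∃ l, p < l ∧ ∃ z ∈ EE s l, |g t - z| ≤ ε := by
  have hd := C.hd0
  obtain ⟨κ, hκ, hlu⟩ := G'.lu C (η := 1) one_pos
  have hg1 : 0 < g 1 := by rw [← G.zero]; exact g.strictMono one_pos
  set e := min ε (min κ (g 1)) with he
  have he0 : 0 < e := by positivity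
  have he1 : e ≤ ε := min_le_left _ _
  have he2 : e ≤ κ := le_trans (min_le_right _ _) (min_le_left _ _)
  have he3 : e ≤ g 1 := le_trans (min_le_right _ _) (min_le_right _ _)
  obtain ⟨q0, κ', hκ', huc⟩ := G.uc p (e / 2) (by linarith)
  obtain ⟨N, hN⟩ := C.big (2 + 1 / δ)
  refine ⟨q0 + N + 1, fun r hr t ht => ?_⟩
  by_contra hc
  push Not at hc
  have hbr := hN r (by omega)
  have hd1 : 0 < 1 / δ := by positivity
  have ht1 : 1 ≤ t := by have := EE_ge C ht; linarith
  have hdr : 1 ≤ δ * s ^ r := by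
    have : δ * (1 / δ) = 1 := by field_simp
    nlinarith
  have hgt : g 1 ≤ g t := g.monotone ht1
  obtain ⟨σ, hσ, hf⟩ := ff_affine C p (x := g t - e) (y := g t + e) (by linarith)
    (fun i hi z hz hzi => by
      have := hc i hi z hzi
      have h2 : |g t - z| < e := by rw [abs_lt]; constructor <;> linarith [hz.1, hz.2]
      linarith)
  have r1 := hlu (g t + e) (g t) (by linarith) (by linarith) (by simp [abs_of_pos he0, he2])
  have r2 := hlu (g t) (g t - e) (by linarith) (by linarith) (by simp [abs_of_pos he0, he2])
  rw [g.symm_apply_apply, abs_le] at r1 r2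
  have c1 : t ≤ g.symm (g t + e) := g.le_symm_apply.2 (by linarith)
  have c2 : g.symm (g t - e) ≤ t := g.symm_apply_le.2 (by linarith)
  obtain ⟨v, hv0, hv1, hv2, hv3, hv4⟩ : ∃ v, 0 ≤ v ∧ v ≤ 1 ∧ g (t + v) ≤ g t + e ∧
      g t - e ≤ g (t - v) ∧ e ≤ g (t + v) - g (t - v) := by
    rcases le_total (g.symm (g t + e) - t) (t - g.symm (g t - e)) with h | h
    · refine ⟨g.symm (g t + e) - t, by linarith, by linarith, ?_, ?_, ?_⟩
      · rw [add_sub_cancel, g.apply_symm_apply]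
      · exact g.symm_apply_le.1 (by linarith)
      · rw [add_sub_cancel, g.apply_symm_apply]
        have := g.monotone (show t - (g.symm (g t + e) - t) ≤ t by linarith)
        linarith
    · refine ⟨t - g.symm (g t - e), by linarith, by linarith, ?_, ?_, ?_⟩
      · exact g.le_symm_apply.1 (by linarith)
      · rw [sub_sub_cancel, g.apply_symm_apply]
      · rw [sub_sub_cancel, g.apply_symm_apply]
        have := g.monotone (show t ≤ t + (t - g.symm (g t - e)) by linarith)
        linarith
  have m := EE_mirror C (show q0 < r by omega) ht (v := v) (by rw [abs_of_nonneg hv0]; linarith)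
  have h5 := huc (t + v) (t - v) (by linarith) (by linarith) (by rw [m]; simpa using hκ'.le)
  have o : g (t - v) ≤ g (t + v) := g.monotone (by linarith)
  rw [hf (g (t + v)) ⟨by linarith, hv2⟩, hf (g (t - v)) ⟨hv3, by linarith⟩, abs_le] at h5
  rcases hσ with rfl | rfl <;> linarith

theorem far_point {s δ : ℝ} (C : Ctx s δ) {j : ℕ} (hj : δ ≤ (s - 1) * (s ^ j / 2)) {z : ℝ}
    (hz : z ∈ TP s) : δ ≤ |(2 - s) * (s ^ j / 2) - z| := by
  obtain ⟨i, hi, hzi⟩ := hz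
  have hd := C.hd0
  rcases lt_or_ge i j with h | h
  · have m := first_mirror C h (v := (s - 1) * (s ^ j / 2))
      (by rw [abs_of_nonneg (by linarith)])
    have f1 := EE_far C (show i < j + 1 by omega) (EE_first C (j + 1))
    have e1 : s ^ j / 2 + (s - 1) * (s ^ j / 2) = s ^ (j + 1) / 2 := by rw [pow_succ]; ring
    have e2 : s ^ j / 2 - (s - 1) * (s ^ j / 2) = (2 - s) * (s ^ j / 2) := by ring
    rw [e1, e2] at m
    rw [m] at f1
    have l := ff_lip C i ((2 - s) * (s ^ j / 2)) z
    rw [EE, mem_ofPred_eq] at hzi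
    rw [hzi] at l
    have := C.b1 i
    nlinarith
  · have h1 := EE_ge C hzi
    have h2 := C.bmono h
    rw [abs_sub_comm, abs_of_nonneg (by linarith)]
    linarith

/-- lifting lemma at the points `s ^ j / 2` -/
theorem GU.ll {s δ : ℝ} {g : ℝ ≃o ℝ} (C : Ctx s δ) (G : GU s g) {ε : ℝ} (hε : 0 < ε)
    (hε2 : 100 * ε ≤ δ) : ∃ j0 : ℕ, ∀ j, j0 ≤ j → ∀ l y, 1 ≤ l → y ∈ EE s l →
      |g (s ^ j / 2) - y| ≤ ε → ∀ v, 0 ≤ v → v ≤ (s - 1) * (s ^ j / 2) →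
      (∀ r, r < l → |ff s r (g (s ^ j / 2 + v)) - ff s r (g (s ^ j / 2 - v))| ≤ 25 * ε) ∧
      |ff s l (g (s ^ j / 2 + v)) + ff s l (g (s ^ j / 2 - v)) - s ^ l| ≤ 25 * ε := by
  obtain ⟨τ, T⟩ := exists_tau C
  obtain ⟨q, κ, hκ, huc⟩ := G.uc 0 ε hε
  obtain ⟨N, hN⟩ := C.big (2 * (g.symm (τ 0 + 20 * ε) / (2 - s)))
  refine ⟨q + 1 + N, fun j hj l y hl hy hgy v hv0 hvV => ?_⟩
  have hs2 : 0 < 2 - s := by linarith [C.h2]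
  have hs1 := C.h1
  have hb := C.b0 j
  obtain ⟨i, rfl⟩ := T.surj y ⟨l, hl, hy⟩
  refine LL T C (V := (s - 1) * (s ^ j / 2)) ⟨hε, hε2, by nlinarith, hl, hy, hgy, ?_, ?_⟩ hv0 hvV
  · intro v hv0 hv1
    have m := first_mirror C (show q < j by omega) (v := v) (by rw [abs_of_nonneg hv0]; exact hv1)
    exact huc _ _ (by nlinarith) (by nlinarith) (by rw [m]; simpa using hκ.le)
  · refine g.symm_apply_le.1 ?_
    have h1 := hN j (by omega)
    have h2 : g.symm (τ 0 + 20 * ε) / (2 - s) ≤ s ^ j / 2 := by linarith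
    rw [div_le_iff₀ hs2] at h2
    linarith

theorem eventually_succ (l : ℕ → ℕ) (j0 D : ℕ) (h1 : ∀ j, j0 ≤ j → l j < l (j + 1))
    (h2 : ∀ j, j0 ≤ j → l j ≤ j + D) : ∃ J, j0 ≤ J ∧ ∀ i, l (J + i) = l J + i := by
  by_contra hc
  push Not at hc
  have key : ∀ n : ℕ, ∃ j, j0 ≤ j ∧ j + n ≤ l j + j0 := by
    intro n
    induction n with
    | zero =>
      exact ⟨j0, le_rfl, by omega⟩
    | succ n ih =>
      obtain ⟨j, hj, hn⟩ := ih
      obtain ⟨i, hi⟩ := hc j hj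
      have hge : ∀ i, l j + i ≤ l (j + i) := by
        intro i
        induction i with
        | zero => simp
        | succ i ih =>
          have := h1 (j + i) (by omega)
          rw [show j + (i + 1) = j + i + 1 by omega]
          omega
      have := hge i
      exact ⟨j + i, by omega, by omega⟩
  obtain ⟨j, hj, hn⟩ := key (D + j0 + 1)
  have := h2 j hj
  omega

theorem levels {s δ : ℝ} {g : ℝ ≃o ℝ} (C : Ctx s δ) (G : GU s g) (G' : GU s g.symm) :
    ∃ (ε : ℝ) (J L : ℕ), 0 < ε ∧ 100 * ε ≤ δ ∧ 1 ≤ L ∧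
      (∀ i, |g (s ^ (J + i) / 2) - s ^ (L + i) / 2| ≤ ε) ∧
      (∀ i v, 0 ≤ v → v ≤ (s - 1) * (s ^ (J + i) / 2) →
        |ff s (L + i) (g (s ^ (J + i) / 2 + v)) + ff s (L + i) (g (s ^ (J + i) / 2 - v))
          - s ^ (L + i)| ≤ 25 * ε) ∧
      (∀ r, J ≤ r → ∀ t ∈ EE s r, ∃ z ∈ TP s, |g t - z| ≤ ε) := by
  have hd := C.hd0
  have hs1 := C.h1
  have hs2 := C.h2
  obtain ⟨κ, hκ, hlu⟩ := G'.lu C (η := δ / 4) (by linarith)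
  obtain ⟨ε, hε0, hε1, hε2, hε3⟩ : ∃ ε : ℝ, 0 < ε ∧ 100 * ε ≤ δ ∧ 26 * ε ≤ κ ∧
      26 * ε < (s - 1) * (1 - s / 2) := by
    have h3 : 0 < (s - 1) * (1 - s / 2) := mul_pos (by linarith) (by linarith)
    refine ⟨min (δ / 100) (min (κ / 26) ((s - 1) * (1 - s / 2) / 27)), by positivity, ?_, ?_, ?_⟩
    · have := min_le_left (δ / 100) (min (κ / 26) ((s - 1) * (1 - s / 2) / 27)); linarith
    · have := min_le_right (δ / 100) (min (κ / 26) ((s - 1) * (1 - s / 2) / 27))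
      have := min_le_left (κ / 26) ((s - 1) * (1 - s / 2) / 27); linarith
    · have := min_le_right (δ / 100) (min (κ / 26) ((s - 1) * (1 - s / 2) / 27))
      have := min_le_right (κ / 26) ((s - 1) * (1 - s / 2) / 27); linarith
  obtain ⟨q2, hq2⟩ := G'.near C G 0 (ε := δ / 4) (by linarith)
  obtain ⟨j1, hj1⟩ := G.near C G' q2 hε0
  obtain ⟨j2, hj2⟩ := G.ll C hε0 hε1
  obtain ⟨j3, hj3⟩ := C.big (2 * δ / (s - 1))
  obtain ⟨κ2, hκ2, hcoarse⟩ := G.coarse C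
  have hex : ∀ j : ℕ, ∃ l : ℕ, ∃ z : ℝ, j1 ≤ j → q2 < l ∧ z ∈ EE s l ∧ |g (s ^ j / 2) - z| ≤ ε := by
    intro j
    by_cases h : j1 ≤ j
    · obtain ⟨l, hl, z, hz, hh⟩ := hj1 j h _ (EE_first C j)
      exact ⟨l, z, fun _ => ⟨hl, hz, hh⟩⟩
    · exact ⟨0, 0, fun h' => absurd h' h⟩
  choose l y hly using hex
  set j0 := j1 + j2 + j3 with hj0
  have hl : ∀ j, j0 ≤ j → q2 < l j := fun j hj => (hly j (by omega)).1
  have hy : ∀ j, j0 ≤ j → y j ∈ EE s (l j) := fun j hj => (hly j (by omega)).2.1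
  have hgy : ∀ j, j0 ≤ j → |g (s ^ j / 2) - y j| ≤ ε := fun j hj => (hly j (by omega)).2.2
  have hLL := fun j (hj : j0 ≤ j) => hj2 j (by omega) (l j) (y j) (by have := hl j hj; omega)
    (hy j hj) (hgy j hj)
  have eV : ∀ j : ℕ, s ^ j / 2 + (s - 1) * (s ^ j / 2) = s ^ (j + 1) / 2 := by
    intro j; rw [pow_succ]; ring
  have eV' : ∀ j : ℕ, s ^ j / 2 - (s - 1) * (s ^ j / 2) = (2 - s) * (s ^ j / 2) := by
    intro j; ring
  have hVj : ∀ j, j0 ≤ j → δ ≤ (s - 1) * (s ^ j / 2) := by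
    intro j hj
    have h := hj3 j (by omega)
    rw [div_lt_iff₀ (by linarith)] at h
    linarith
  -- strict monotonicity of levels
  have hinc : ∀ j, j0 ≤ j → l j < l (j + 1) := by
    intro j hj
    by_contra hc
    push Not at hc
    have hV := hVj j hj
    have H := hLL j hj ((s - 1) * (s ^ j / 2)) (by linarith) le_rfl
    rw [eV, eV'] at H
    have hy1 := hy (j + 1) (by omega)
    have hg1 := le_trans (ff_lip C (l (j+1)) _ _) (hgy (j + 1) (by omega))
    rw [EE, mem_ofPred_eq] at hy1
    rw [hy1] at hg1
    have hw : |ff s (l (j+1)) (g ((2 - s) * (s ^ j / 2))) - s ^ (l (j+1)) / 2| ≤ 26 * ε := by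
      rcases hc.lt_or_eq with h | h
      · have h1 := H.1 _ h
        rw [abs_le] at *
        constructor <;> linarith
      · have h1 := H.2
        rw [← h] at h1
        rw [abs_le] at *
        constructor <;> linarith
    have hb1 := C.b1 (l (j+1))
    obtain ⟨z, hz, hzw⟩ := EE_near C hw (by nlinarith)
    have hz0 : 0 ≤ z := by have := EE_ge C hz; linarith
    have hb := C.b0 j
    have hw0 : 0 ≤ g ((2 - s) * (s ^ j / 2)) := G.nonneg (by nlinarith)
    have h3 := hlu z _ hz0 hw0 (by linarith)
    rw [g.symm_apply_apply] at h3
    obtain ⟨l', hl', z', hz', hzz⟩ := hq2 (l (j+1)) (hl (j+1) (by omega)).le z hz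
    have h4 := far_point C hV ⟨l', hl', hz'⟩
    have h5 := abs_sub_le ((2 - s) * (s ^ j / 2)) (g.symm z) z'
    rw [abs_sub_comm _ (g.symm z)] at h5
    linarith
  -- the first point is hit when the level increases by one
  have hfirst : ∀ j, j0 ≤ j → l (j + 1) = l j + 1 → y j = s ^ (l j) / 2 := by
    intro j hj hlj
    by_contra hne
    have hV := hVj j hj
    have hyj := hy j hj
    have hy1 := hy (j + 1) (by omega)
    set n := l j with hn
    have hn1 : 1 ≤ n := by have := hl j hj; omega
    rw [hlj] at hy1
    have ho := EE_other C hyj hne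
    have hgap := TP_gap C (x := s ^ (n + 1) / 2) (y := y j) ⟨n + 1, by omega, EE_first C _⟩
      ⟨n, hn1, hyj⟩ ho
    have H := (hLL j hj ((s - 1) * (s ^ j / 2)) (by linarith) le_rfl).2
    rw [eV, eV', ← hn] at H
    have hfy : ff s n (y (j + 1)) = s ^ (n + 1) / 2 := by
      rw [EE, mem_ofPred_eq] at hy1
      rw [ff_succ C, hy1, min_eq_left (by linarith)]
    have hg1 := le_trans (ff_lip C n _ _) (hgy (j + 1) (by omega))
    rw [hfy] at hg1
    have hbn := C.b1 n
    have hps : s ^ (n + 1) = s ^ n * s := pow_succ s n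
    have hA : s ^ (n + 1) * (1 - s / 2) =
        s ^ n * (1 - s / 2) + s ^ n * ((s - 1) * (1 - s / 2)) := by rw [hps]; ring
    have hB : s ^ (n + 1) / 2 = s ^ n - s ^ n * (1 - s / 2) := by rw [hps]; ring
    have hcontra : (s - 1) * (1 - s / 2) ≤ s ^ n * ((s - 1) * (1 - s / 2)) := by nlinarith
    have hwV : g ((2 - s) * (s ^ j / 2)) < s ^ (n + 1) / 2 := by
      by_contra hh
      push Not at hh
      have ht := ff_tail C hh
      rw [abs_le] at H hg1
      linarith
    have hg0 := hgy j hj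
    rw [abs_le] at hg0
    set v := s ^ j / 2 - g.symm (s ^ (n + 1) / 2) with hv
    have hv0 : 0 ≤ v := by
      have : g.symm (s ^ (n + 1) / 2) ≤ s ^ j / 2 := g.symm_apply_le.2 (by linarith)
      linarith
    have hv1 : v ≤ (s - 1) * (s ^ j / 2) := by
      have := g.le_symm_apply.2 hwV.le
      linarith [eV' j]
    have H2 := (hLL j hj v hv0 hv1).2
    have hwv : g (s ^ j / 2 - v) = s ^ (n + 1) / 2 := by
      rw [hv, sub_sub_cancel, g.apply_symm_apply]
    have huv : s ^ (n + 1) / 2 ≤ g (s ^ j / 2 + v) := by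
      rw [← hwv]; exact g.monotone (by linarith)
    rw [hwv, ← hn, ff_id C le_rfl] at H2
    have ht := ff_tail C huv
    rw [abs_le] at H2
    linarith
  -- boundedness
  obtain ⟨D, hD⟩ := C.big (1 / κ2 + 2 * (1 + ε))
  have hbdd : ∀ j, j0 ≤ j → l j ≤ j + D := by
    intro j hj
    by_contra hc
    push Not at hc
    have h1 := EE_ge C (hy j hj)
    have h2 := hgy j hj
    have h3 := hcoarse (s ^ j / 2) (by have := C.b0 j; positivity)
    have h4 := C.bmono hc.le
    rw [pow_add] at h4
    have h5 := hD D le_rfl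
    have h6 := C.b1 j
    rw [abs_le] at h2
    have h7 : s ^ j / 2 / κ2 = s ^ j * (1 / κ2) / 2 := by field_simp
    rw [h7] at h3
    nlinarith
  obtain ⟨J, hJ, hJl⟩ := eventually_succ l j0 D hinc hbdd
  refine ⟨ε, J, l J, hε0, hε1, by have := hl J hJ; omega, ?_, ?_, ?_⟩
  · intro i
    have h1 := hfirst (J + i) (by omega) (by rw [add_assoc, hJl, hJl]; omega)
    have h2 := hgy (J + i) (by omega)
    rw [h1, hJl] at h2
    exact h2
  · intro i v hv0 hv1
    have := (hLL (J + i) (by omega) v hv0 hv1).2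
    rw [hJl] at this
    exact this
  · intro r hr t ht
    obtain ⟨l, hl, z, hz, hh⟩ := hj1 r (by omega) t ht
    exact ⟨z, ⟨l, by omega, hz⟩, hh⟩

theorem EE_iff {s δ : ℝ} (C : Ctx s δ) {r : ℕ} {t : ℝ} : t ∈ EE s r ↔ rayF s (t / s ^ r) = 1 / 2 := by
  have := C.b0 r
  rw [EE, mem_ofPred_eq, ff]
  constructor
  · intro h
    have h2 : s ^ r * (rayF s (t / s ^ r) - 1 / 2) = 0 := by linarith
    rcases mul_eq_zero.1 h2 with h3 | h3
    · linarith
    · linarith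
  · intro h; rw [h]; ring

theorem EE_rescale {s δ : ℝ} (C : Ctx s δ) {J L k : ℕ} {t : ℝ} (h : t ∈ EE s (J + k)) :
    s ^ L / s ^ J * t ∈ EE s (L + k) := by
  have := C.b0 L
  have := C.b0 J
  have := C.b0 k
  rw [EE_iff C] at h ⊢
  rw [← h, pow_add, pow_add]
  congr 1
  field_simp

/-- asymptotics of the ray map at turning points of high level -/
theorem asymp {s δ : ℝ} {g : ℝ ≃o ℝ} (C : Ctx s δ) (G : GU s g) (G' : GU s g.symm) :
    ∃ J L : ℕ, ∀ ε : ℝ, 0 < ε → ∃ N : ℕ, ∀ r, N ≤ r → ∀ t ∈ EE s r,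
      |g t - s ^ L / s ^ J * t| ≤ ε := by
  obtain ⟨ε, J, L, hε, hε2, hL, h1, h2, h3⟩ := levels C G G'
  have hd := C.hd0
  have hs1 := C.h1
  set ρ := s ^ L / s ^ J with hρ
  have hρt : ∀ i, ρ * (s ^ (J + i) / 2) = s ^ (L + i) / 2 := by
    intro i
    have := C.b0 J
    rw [hρ, pow_add, pow_add]; field_simp
  have hTP : ∀ r, J ≤ r → ∀ t ∈ EE s r, ρ * t ∈ TP s := by
    intro r hr t ht
    obtain ⟨k, rfl⟩ := Nat.exists_eq_add_of_le hr
    exact ⟨L + k, by omega, EE_rescale C ht⟩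
  have main : ∀ j : ℕ, ∀ t, t ≤ s ^ (J + j) / 2 → ∀ r, J ≤ r → t ∈ EE s r → |g t - ρ * t| ≤ ε := by
    intro j
    induction j with
    | zero =>
      intro t ht r hr htr
      have a1 := EE_ge C htr
      have a2 := C.bmono hr
      have : t = s ^ (J + 0) / 2 := le_antisymm ht (by simpa using by linarith)
      rw [this, hρt]
      exact h1 0
    | succ j ih =>
      intro t ht r hr htr
      rcases le_or_gt t (s ^ (J + j) / 2) with hle | hgt
      · exact ih t hle r hr htr
      rcases ht.eq_or_lt with heq | hlt
      · rw [heq, hρt]; exact h1 _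
      have hrm : r < J + j := by
        by_contra hc
        push Not at hc
        rcases hc.eq_or_lt with h | h
        · have := EE_other C htr (by rw [← h]; exact hgt.ne')
          rw [← h] at this
          rw [← add_assoc] at hlt
          linarith
        · have a1 := EE_ge C htr
          have a2 := C.bmono (show J + (j + 1) ≤ r by omega)
          linarith
      set v := t - s ^ (J + j) / 2 with hv
      have hv0 : 0 ≤ v := by linarith
      have hv1 : v ≤ (s - 1) * (s ^ (J + j) / 2) := by
        rw [← add_assoc, pow_succ] at hlt
        linarith
      have m := first_mirror C hrm (v := v) (by rw [abs_of_nonneg hv0]; exact hv1)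
      have hplus : s ^ (J + j) / 2 + v = t := by rw [hv]; ring
      have H := h2 j v hv0 hv1
      rw [hplus] at H m
      set t' := s ^ (J + j) / 2 - v with ht'
      have ht'E : t' ∈ EE s r := by
        rw [EE, mem_ofPred_eq] at htr ⊢; rw [← m]; exact htr
      have I := ih t' (by linarith) r hr ht'E
      have b1 := h1 (j + 1)
      have gle : g t ≤ g (s ^ (J + (j + 1)) / 2) := g.monotone hlt.le
      have gle' : g t' ≤ g t := g.monotone (by linarith)
      have near_id : ∀ y, y ≤ s ^ (L + j + 1) / 2 + ε → |ff s (L + j) y - y| ≤ 2 * ε := by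
        intro y hy
        rcases le_total y (s ^ (L + j + 1) / 2) with h | h
        · rw [ff_id C h]; simp; linarith
        · have e1 := ff_lip C (L + j) y (s ^ (L + j + 1) / 2)
          rw [ff_id C (t := s ^ (L + j + 1) / 2) le_rfl, abs_of_nonneg (show 0 ≤ y - _ by linarith)]
            at e1
          rw [abs_le] at e1 ⊢
          constructor <;> linarith
      rw [abs_le] at b1
      rw [← add_assoc L] at b1
      have c1 := near_id (g t) (by linarith)
      have c2 := near_id (g t') (by linarith)
      obtain ⟨z, hz, hgz⟩ := h3 r hr t htr
      have hsum : ρ * t + ρ * t' = s ^ (L + j) := by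
        have := hρt j
        rw [ht', ← hplus]
        linarith
      have close : |g t - ρ * t| ≤ 30 * ε := by
        rw [abs_le] at *
        constructor <;> linarith
      have : z = ρ * t := by
        refine TP_eq C hz (hTP r hr t htr) ?_
        rw [abs_le] at close hgz
        rw [abs_lt]
        constructor <;> linarith
      rw [← this]
      exact hgz
  refine ⟨J, L, fun ε' hε' => ?_⟩
  obtain ⟨q, hq⟩ := G.near C G' 0 (ε := min ε' (δ / 4)) (by positivity)
  refine ⟨q + J, fun r hr t ht => ?_⟩
  obtain ⟨l, hl, z, hz, hgz⟩ := hq r (by omega) t ht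
  have c : |g t - ρ * t| ≤ ε := by
    obtain ⟨N, hN⟩ := C.big (2 * t)
    exact main N t (by have := hN (J + N) (by omega); linarith) r (by omega) ht
  have : z = ρ * t := by
    refine TP_eq C ⟨l, hl, hz⟩ (hTP r (by omega) t ht) ?_
    have := le_trans hgz (min_le_right _ _)
    rw [abs_le] at c this
    rw [abs_lt]
    constructor <;> linarith
  rw [← this]
  exact le_trans hgz (min_le_left _ _)

theorem tent_cont (s : ℝ) : Continuous (tent s) := by
  unfold tent; fun_prop

theorem tent_le {s δ : ℝ} (C : Ctx s δ) (x : ℝ) : tent s x ≤ s / 2 := by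
  have hs := C.s0
  rcases le_total x (1 / 2) with h | h
  · exact le_trans (min_le_left _ _) (by nlinarith)
  · exact le_trans (min_le_right _ _) (by nlinarith)

theorem tent_lip {s δ : ℝ} (C : Ctx s δ) (x y : ℝ) : |tent s x - tent s y| ≤ s * |x - y| := by
  have hs := C.s0
  refine le_trans (abs_min_sub_min_le_max _ _ _ _) ?_
  rw [← mul_sub, ← mul_sub, sub_sub_sub_cancel_left, abs_mul, abs_mul, abs_sub_comm y, abs_of_pos hs]
  simp

theorem invLim_closed (s : ℝ) : IsClosed (invLim s) := by
  have : invLim s = (⋂ n, {x : ℕ → ℝ | x n ∈ Icc (0 : ℝ) 1}) ∩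
      ⋂ n, {x : ℕ → ℝ | x n = tent s (x (n + 1))} := by
    ext x; simp [invLim]
  rw [this]
  refine IsClosed.inter (isClosed_iInter fun n => ?_) (isClosed_iInter fun n => ?_)
  · exact isClosed_Icc.preimage (continuous_apply n)
  · exact isClosed_eq (continuous_apply n) ((tent_cont s).comp (continuous_apply (n + 1)))

theorem invLim_compact (s : ℝ) : CompactSpace (invLim s) := by
  rw [← isCompact_iff_compactSpace]
  refine IsCompact.of_isClosed_subset (isCompact_univ_pi (fun _ : ℕ => isCompact_Icc (a := (0:ℝ))
    (b := 1))) (invLim_closed s) ?_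
  intro x hx n _
  exact hx.1 n

theorem proj_cont (s : ℝ) (n : ℕ) : Continuous fun x : invLim s => x.1 n :=
  (continuous_apply n).comp continuous_subtype_val

theorem K_le {s δ : ℝ} (C : Ctx s δ) (x : invLim s) (n : ℕ) : x.1 n ≤ s / 2 := by
  rw [x.2.2 n]; exact tent_le C _

theorem K_iter {s : ℝ} (x : invLim s) (n k : ℕ) : x.1 n = (tent s)^[k] (x.1 (n + k)) := by
  induction k with
  | zero => rfl
  | succ k ih =>
    rw [ih, x.2.2 (n + k), ← Function.iterate_succ_apply]
    rfl

theorem K_eq_of {s : ℝ} {x y : invLim s} {n : ℕ} (h : x.1 n = y.1 n) {m : ℕ} (hm : m ≤ n) :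
    x.1 m = y.1 m := by
  obtain ⟨k, rfl⟩ := Nat.exists_eq_add_of_le hm
  rw [K_iter x m k, K_iter y m k, h]

/-- the parametrised ray -/
def phi {s δ : ℝ} (C : Ctx s δ) (t : ℝ) : invLim s :=
  ⟨fun n => ff s n (max t 0) / s ^ n, fun n => by
    have hb := C.b0 n
    have h1 := ff_nonneg C n (le_max_right t 0)
    have h2 := ff_le C n (max t 0)
    refine ⟨by positivity, ?_⟩
    rw [div_le_one hb]
    rw [pow_succ] at h2
    nlinarith [C.h2], fun n => by
    have hb := C.b0 n
    have hs := C.s0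
    show ff s n (max t 0) / s ^ n = tent s (ff s (n+1) (max t 0) / s ^ (n+1))
    rw [ff_succ C, tent, ← min_div_div_right hb.le, pow_succ]
    congr 1 <;> field_simp⟩

theorem phi_apply {s δ : ℝ} (C : Ctx s δ) {t : ℝ} (ht : 0 ≤ t) (n : ℕ) :
    (phi C t).1 n = ff s n t / s ^ n := by
  show ff s n (max t 0) / s ^ n = _
  rw [max_eq_left ht]

theorem phi_max {s δ : ℝ} (C : Ctx s δ) (t : ℝ) : phi C (max t 0) = phi C t := by
  apply Subtype.ext
  funext n
  show ff s n (max (max t 0) 0) / s ^ n = ff s n (max t 0) / s ^ n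
  rw [max_eq_left (le_max_right t 0)]

theorem phi_cont {s δ : ℝ} (C : Ctx s δ) : Continuous (phi C) := by
  refine Continuous.subtype_mk (continuous_pi fun n => ?_) _
  exact ((ff_cont C n).comp (by fun_prop)).div_const _

theorem phi_inj {s δ : ℝ} (C : Ctx s δ) {t t' : ℝ} (ht : 0 ≤ t) (ht' : 0 ≤ t')
    (h : phi C t = phi C t') : t = t' := by
  obtain ⟨N, hN⟩ := C.big (2 * max t t')
  have hb := C.b0 N
  have h1 : (phi C t).1 N = (phi C t').1 N := by rw [h]
  have h2 := hN (N+1) (by omega)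
  rw [phi_apply C ht, phi_apply C ht', ff_id C (by linarith [le_max_left t t']),
    ff_id C (by linarith [le_max_right t t']), div_left_inj' hb.ne'] at h1
  exact h1

theorem small_eq_phi {s δ : ℝ} (C : Ctx s δ) (x : invLim s) (n : ℕ)
    (h : x.1 n < s * (1 - s / 2)) : x = phi C (s ^ n * x.1 n) := by
  have hs := C.s0
  have hs1 := C.h1
  have hs2 := C.h2
  have step : ∀ k, x.1 (n + k) = x.1 n / s ^ k ∧ x.1 (n + k) < s * (1 - s / 2) := by
    intro k
    induction k with
    | zero => simpa using h
    | succ k ih =>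
      have e := x.2.2 (n + k)
      have hle := K_le C x (n + k + 1)
      have hle1 : x.1 (n + k + 1) ≤ 1 / 2 := by
        by_contra hc
        push Not at hc
        rw [tent, min_eq_right (by nlinarith)] at e
        nlinarith [ih.2]
      rw [tent, min_eq_left (by nlinarith)] at e
      have e2 : x.1 (n + k + 1) = x.1 (n + k) / s := by rw [e]; field_simp
      rw [← add_assoc, e2, ih.1, pow_succ]
      refine ⟨by field_simp, ?_⟩
      have := ih.2
      rw [ih.1] at this
      have h0 : 0 ≤ x.1 n / s ^ k := div_nonneg (x.2.1 n).1 (C.b0 k).le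
      refine lt_of_le_of_lt (div_le_self h0 hs1.le) this
  have hx0 := (x.2.1 n).1
  have ht : 0 ≤ s ^ n * x.1 n := mul_nonneg (C.b0 n).le hx0
  have hi : ∀ k, x.1 (n + k) = (phi C (s ^ n * x.1 n)).1 (n + k) := by
    intro k
    have hk := C.b1 k
    have hn := C.b0 n
    have hle := K_le C x n
    rw [phi_apply C ht, ff_id C, (step k).1, pow_add]
    · field_simp
    · rw [pow_succ, pow_add]
      have : s ^ n * x.1 n ≤ s ^ n * (s / 2) := by gcongr
      have h3 : s ^ n * (s / 2) * 1 ≤ s ^ n * (s / 2) * s ^ k := by gcongr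
      linarith
  apply Subtype.ext
  funext m
  rcases le_total m n with hm | hm
  · exact K_eq_of (hi 0) hm
  · obtain ⟨k, rfl⟩ := Nat.exists_eq_add_of_le hm
    exact hi k

theorem phi_small {s δ : ℝ} (C : Ctx s δ) {t : ℝ} (ht : 0 ≤ t) :
    ∃ n, (phi C t).1 n < s * (1 - s / 2) := by
  have h2 : 0 < s * (1 - s / 2) := mul_pos C.s0 (by linarith [C.h2])
  obtain ⟨N, hN⟩ := C.big (2 * t + t / (s * (1 - s / 2)))
  have hb := C.b0 N
  have h3 := hN N le_rfl
  have h4 := C.bmono (show N ≤ N + 1 by omega)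
  have h5 : 0 ≤ t / (s * (1 - s / 2)) := by positivity
  refine ⟨N, ?_⟩
  rw [phi_apply C ht, ff_id C (by linarith), div_lt_iff₀ hb]
  have h6 : t / (s * (1 - s / 2)) < s ^ N := by linarith
  rw [div_lt_iff₀ h2] at h6
  linarith

/-- the composant of the fixed end point -/
def C0 {s δ : ℝ} (C : Ctx s δ) : Set (invLim s) := range (phi C)

theorem C0_exists {s δ : ℝ} (C : Ctx s δ) {x : invLim s} (h : x ∈ C0 C) :
    ∃ t, 0 ≤ t ∧ phi C t = x := by
  obtain ⟨t, rfl⟩ := h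
  exact ⟨max t 0, le_max_right _ _, phi_max C t⟩

theorem C0_eq {s δ : ℝ} (C : Ctx s δ) :
    C0 C = ⋃ n, {x : invLim s | x.1 n < s * (1 - s / 2)} := by
  ext x
  constructor
  · intro h
    obtain ⟨t, ht, rfl⟩ := C0_exists C h
    exact mem_iUnion.2 (phi_small C ht)
  · intro h
    obtain ⟨n, hn⟩ := mem_iUnion.1 h
    exact ⟨_, (small_eq_phi C x n hn).symm⟩

theorem C0_open {s δ : ℝ} (C : Ctx s δ) : IsOpen (C0 C) := by
  rw [C0_eq C]
  exact isOpen_iUnion fun n => isOpen_lt (proj_cont s n) continuous_const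

theorem approx {s δ : ℝ} (C : Ctx s δ) (x : invLim s) (N : ℕ) :
    ∀ m, m ≤ N → (phi C (s ^ N * x.1 N)).1 m = x.1 m := by
  intro m hm
  have hb := C.b0 N
  have hx0 := (x.2.1 N).1
  refine K_eq_of (n := N) ?_ hm
  have hle := K_le C x N
  rw [phi_apply C (by positivity), ff_id C]
  · field_simp
  · rw [pow_succ]; nlinarith

theorem C0_dense {s δ : ℝ} (C : Ctx s δ) : Dense (C0 C) := by
  intro x
  refine mem_closure_of_tendsto (f := fun N : ℕ => phi C (s ^ N * x.1 N)) (b := atTop) ?_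
    (Eventually.of_forall fun N => ⟨_, rfl⟩)
  rw [tendsto_subtype_rng, tendsto_pi_nhds]
  intro m
  refine tendsto_const_nhds.congr' ?_
  filter_upwards [eventually_ge_atTop m] with N hN
  exact (approx C x N m hN).symm

open Classical in
/-- inverse of the parametrisation -/
def par {s δ : ℝ} (C : Ctx s δ) (x : invLim s) : ℝ :=
  if h : ∃ t, 0 ≤ t ∧ phi C t = x then h.choose else 0

theorem par_phi {s δ : ℝ} (C : Ctx s δ) {t : ℝ} (ht : 0 ≤ t) : par C (phi C t) = t := by
  have h : ∃ t', 0 ≤ t' ∧ phi C t' = phi C t := ⟨t, ht, rfl⟩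
  rw [par, dif_pos h]
  exact phi_inj C h.choose_spec.1 ht h.choose_spec.2

theorem phi_par {s δ : ℝ} (C : Ctx s δ) {x : invLim s} (h : x ∈ C0 C) : phi C (par C x) = x := by
  obtain ⟨t, ht, rfl⟩ := C0_exists C h
  rw [par_phi C ht]

theorem par_nonneg {s δ : ℝ} (C : Ctx s δ) {x : invLim s} (h : x ∈ C0 C) : 0 ≤ par C x := by
  obtain ⟨t, ht, rfl⟩ := C0_exists C h
  rwa [par_phi C ht]

theorem par_cont {s δ : ℝ} (C : Ctx s δ) {x : invLim s} (h : x ∈ C0 C) :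
    ContinuousAt (par C) x := by
  rw [C0_eq C] at h
  obtain ⟨n, hn⟩ := mem_iUnion.1 h
  have ho : IsOpen {x : invLim s | x.1 n < s * (1 - s / 2)} :=
    isOpen_lt (proj_cont s n) continuous_const
  have hc : ContinuousAt (fun x : invLim s => s ^ n * x.1 n) x :=
    (continuous_const.mul (proj_cont s n)).continuousAt
  refine hc.congr ?_
  filter_upwards [ho.mem_nhds hn] with y hy
  conv_rhs => rw [small_eq_phi C y n hy]
  rw [par_phi C (mul_nonneg (C.b0 n).le (y.2.1 n).1)]

theorem C0_noexit {s δ : ℝ} (C : Ctx s δ) {x y : invLim s} (hy : y ∈ C0 C) (h : Joined y x) :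
    x ∈ C0 C := by
  by_contra hx
  obtain ⟨γ⟩ := h
  have hd := C.hd0
  have hγ : Continuous γ.extend := γ.continuous_extend
  set A : Set ℝ := Icc (0:ℝ) 1 ∩ γ.extend ⁻¹' (C0 C)ᶜ with hA
  have hAc : IsClosed A := isClosed_Icc.inter ((C0_open C).isClosed_compl.preimage hγ)
  have hAne : A.Nonempty := ⟨1, ⟨zero_le_one, le_rfl⟩, by simpa using hx⟩
  have hAb : BddBelow A := ⟨0, fun v hv => hv.1.1⟩
  set w := sInf A with hw
  have hwA : w ∈ A := hAc.csInf_mem hAne hAb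
  have hin : ∀ v, 0 ≤ v → v < w → γ.extend v ∈ C0 C := by
    intro v hv0 hvw
    by_contra hc
    have : w ≤ v := csInf_le hAb ⟨⟨hv0, by linarith [hwA.1.2]⟩, hc⟩
    linarith
  have hw0 : 0 < w := by
    refine lt_of_le_of_ne hwA.1.1 ?_
    intro h0
    have := hwA.2
    rw [← h0] at this
    simp at this
    exact this hy
  have hesc : ∀ M : ℝ, ∀ᶠ v in 𝓝 w, γ.extend v ∉ phi C '' Icc 0 M := by
    intro M
    have hcl : IsClosed (phi C '' Icc 0 M) := (isCompact_Icc.image (phi_cont C)).isClosed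
    have : γ.extend w ∈ (phi C '' Icc 0 M)ᶜ := by
      rintro ⟨t, -, ht⟩
      exact hwA.2 ⟨t, ht⟩
    exact hγ.continuousAt.eventually (hcl.isOpen_compl.mem_nhds this)
  have hnear : ∀ᶠ v in 𝓝 w, |(γ.extend v).1 0 - (γ.extend w).1 0| < δ / 8 := by
    have hc : Continuous fun v => |(γ.extend v).1 0 - (γ.extend w).1 0| :=
      (((proj_cont s 0).comp hγ).sub continuous_const).abs
    exact hc.continuousAt.eventually (Iio_mem_nhds (by simp; linarith))
  obtain ⟨η, hη, hηb⟩ := Metric.eventually_nhds_iff.1 hnear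
  obtain ⟨v0, hv0, hv0w⟩ := exists_between (show max 0 (w - η) < w from max_lt hw0 (by linarith))
  have hv00 : 0 ≤ v0 := le_trans (le_max_left _ _) hv0.le
  have hv0η : w - η < v0 := lt_of_le_of_lt (le_max_right _ _) hv0
  set P : ℝ → ℝ := fun v => par C (γ.extend v) with hP
  obtain ⟨N, hN⟩ := C.big (2 * P v0)
  have hj := hN (N + 1) (by omega)
  obtain ⟨η', hη', hesc'⟩ := Metric.eventually_nhds_iff.1 (hesc (s ^ (N + 1) / 2 + δ / 2))
  obtain ⟨v1, hv1, hv1w⟩ := exists_between (show max v0 (w - η') < w from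
    max_lt hv0w (by linarith))
  have hv10 : v0 < v1 := lt_of_le_of_lt (le_max_left _ _) hv1
  have hv1η : w - η' < v1 := lt_of_le_of_lt (le_max_right _ _) hv1
  have hPv1 : s ^ (N + 1) / 2 + δ / 2 ≤ P v1 := by
    by_contra hc
    push Not at hc
    have hm := hin v1 (by linarith) hv1w
    refine hesc' (y := v1) (by rw [Real.dist_eq, abs_lt]; constructor <;> linarith)
      ⟨P v1, ⟨par_nonneg C hm, hc.le⟩, phi_par C hm⟩
  have hPc : ContinuousOn P (Icc v0 v1) := by
    intro v hv
    have hm := hin v (by linarith [hv.1]) (by linarith [hv.2])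
    exact (ContinuousAt.comp (par_cont C hm) hγ.continuousAt).continuousWithinAt
  have ivt := intermediate_value_Icc hv10.le hPc
  obtain ⟨a, ha, hPa⟩ := ivt (show s ^ (N + 1) / 2 ∈ _ from ⟨by linarith, by linarith⟩)
  obtain ⟨b, hb, hPb⟩ := ivt (show s ^ (N + 1) / 2 + δ / 2 ∈ _ from ⟨by linarith, by linarith⟩)
  have val : ∀ v ∈ Icc v0 v1, (γ.extend v).1 0 = ff s 0 (P v) := by
    intro v hv
    have hm := hin v (by linarith [hv.1]) (by linarith [hv.2])
    conv_lhs => rw [← phi_par C hm]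
    rw [phi_apply C (par_nonneg C hm)]
    simp [hP]
  have na := hηb (y := a) (by rw [Real.dist_eq, abs_lt]; constructor <;> linarith [ha.1, ha.2])
  have nb := hηb (y := b) (by rw [Real.dist_eq, abs_lt]; constructor <;> linarith [hb.1, hb.2])
  rw [val a ha, hPa] at na
  obtain ⟨σ, hσ, hf⟩ := EE_fold C (show 1 ≤ N + 1 by omega) (EE_first C (N + 1))
  have h2 : |δ / 2| = δ / 2 := abs_of_pos (by linarith)
  rw [val b hb, hPb, hf _ h2.le, h2] at nb
  rw [abs_lt] at na nb
  rcases hσ with rfl | rfl <;> linarith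

theorem C0_joined {s δ : ℝ} (C : Ctx s δ) {x y : invLim s} (hx : x ∈ C0 C) (hy : y ∈ C0 C) :
    Joined x y :=
  ((isPathConnected_range (phi_cont C)).joinedIn x hx y hy).joined

theorem C0_map {s δ : ℝ} (C : Ctx s δ) (h : invLim s ≃ₜ invLim s) {z : invLim s} (hz : z ∈ C0 C) :
    h z ∈ C0 C := by
  have hne : (C0 C ∩ h ⁻¹' (C0 C)).Nonempty :=
    (C0_dense C).inter_open_nonempty _ ((C0_open C).preimage h.continuous) (by
      exact ⟨h.symm z, by simpa using hz⟩) |>.mono (by rintro x ⟨a, b⟩; exact ⟨b, a⟩)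
  obtain ⟨x, hx, hhx⟩ := hne
  refine C0_noexit C hhx ?_
  obtain ⟨γ⟩ := C0_joined C hx hz
  exact ⟨γ.map h.continuous⟩

theorem exists_g {s δ : ℝ} (C : Ctx s δ) (h : invLim s ≃ₜ invLim s) :
    ∃ g : ℝ ≃o ℝ, g 0 = 0 ∧ ∀ t, 0 ≤ t → h (phi C t) = phi C (g t) := by
  have hm : ∀ t, h (phi C t) ∈ C0 C := fun t => C0_map C h ⟨t, rfl⟩
  let U : NNReal → NNReal := fun t => ⟨par C (h (phi C t)), par_nonneg C (hm t)⟩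
  have hUphi : ∀ t : NNReal, phi C (U t) = h (phi C t) := fun t => phi_par C (hm t)
  have hUc : Continuous U := by
    refine Continuous.subtype_mk ?_ _
    refine continuous_iff_continuousAt.2 fun t => ?_
    exact ContinuousAt.comp (f := fun t : NNReal => h (phi C t)) (par_cont C (hm t))
      (h.continuous.comp ((phi_cont C).comp NNReal.continuous_coe)).continuousAt
  have hUi : Injective U := by
    intro t t' htt
    have : h (phi C t) = h (phi C t') := by rw [← hUphi, ← hUphi, htt]
    exact NNReal.coe_injective (phi_inj C t.2 t'.2 (h.injective this))
  have hUs : Surjective U := by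
    intro y
    have hy : h.symm (phi C y) ∈ C0 C := C0_map C h.symm ⟨y, rfl⟩
    refine ⟨⟨par C (h.symm (phi C y)), par_nonneg C hy⟩, ?_⟩
    apply NNReal.coe_injective
    refine phi_inj C (NNReal.coe_nonneg _) y.2 ?_
    refine (hUphi _).trans ?_
    show h (phi C (par C (h.symm (phi C y)))) = _
    rw [phi_par C hy, h.apply_symm_apply]
  have hUm : StrictMono U := by
    rcases hUc.strictMono_of_inj hUi with h1 | h1
    · exact h1
    · exfalso
      obtain ⟨x, hx⟩ := hUs (U 0 + 1)
      have : U x ≤ U 0 := h1.antitone (zero_le (a := x))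
      rw [hx] at this
      have h3 : U 0 < U 0 + 1 := lt_add_one _
      exact absurd this (not_le.2 h3)
  have hU0 : U 0 = 0 := by
    obtain ⟨x, hx⟩ := hUs 0
    have : U 0 ≤ U x := hUm.monotone (zero_le (a := x))
    rw [hx] at this
    exact le_antisymm this (zero_le (a := U 0))
  let F : ℝ → ℝ := fun t => (U t.toNNReal : ℝ) + min t 0
  have hFpos : ∀ t, 0 ≤ t → F t = U t.toNNReal := by
    intro t ht; simp [F, ht]
  have hFneg : ∀ t, t ≤ 0 → F t = t := by
    intro t ht; simp [F, ht, Real.toNNReal_of_nonpos ht, hU0]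
  have hFm : StrictMono F := by
    intro t t' htt
    rcases le_or_gt 0 t with h0 | h0
    · rw [hFpos t h0, hFpos t' (by linarith)]
      exact NNReal.coe_lt_coe.2 (hUm ((Real.toNNReal_lt_toNNReal_iff (by linarith)).2 htt))
    · rw [hFneg t h0.le]
      rcases le_or_gt 0 t' with h1 | h1
      · rw [hFpos t' h1]
        exact lt_of_lt_of_le h0 (NNReal.coe_nonneg _)
      · rw [hFneg t' h1.le]; exact htt
  have hFs : Surjective F := by
    intro y
    rcases le_or_gt 0 y with h0 | h0
    · obtain ⟨x, hx⟩ := hUs ⟨y, h0⟩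
      refine ⟨x, ?_⟩
      refine (hFpos (x : ℝ) (NNReal.coe_nonneg x)).trans ?_
      rw [Real.toNNReal_coe, hx]
      rfl
    · exact ⟨y, hFneg y h0.le⟩
  refine ⟨StrictMono.orderIsoOfSurjective F hFm hFs, ?_, ?_⟩
  · show F 0 = 0
    exact hFneg 0 le_rfl
  · intro t ht
    show _ = phi C (F t)
    rw [hFpos t ht, hUphi, Real.coe_toNNReal t ht]

theorem K_lip {s δ : ℝ} (C : Ctx s δ) (x y : invLim s) {m q : ℕ} (h : m ≤ q) :
    s ^ m * |x.1 m - y.1 m| ≤ s ^ q * |x.1 q - y.1 q| := by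
  induction q, h using Nat.le_induction with
  | base => exact le_rfl
  | succ q hq ih =>
    refine le_trans ih ?_
    rw [x.2.2 q, y.2.2 q, pow_succ, mul_assoc]
    exact mul_le_mul_of_nonneg_left (tent_lip C _ _) (C.b0 q).le

theorem K_uc {s δ : ℝ} (C : Ctx s δ) (G : invLim s → ℝ) (hG : Continuous G) {ε : ℝ} (hε : 0 < ε) :
    ∃ q : ℕ, ∀ x y : invLim s, s ^ q * |x.1 q - y.1 q| ≤ 1 / ((q : ℝ) + 1) → |G x - G y| < ε := by
  by_contra hc
  push Not at hc
  have := invLim_compact s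
  let F : ℕ → Set (invLim s × invLim s) := fun q =>
    {z | s ^ q * |z.1.1 q - z.2.1 q| ≤ 1 / ((q : ℝ) + 1) ∧ ε ≤ |G z.1 - G z.2|}
  have hcl : ∀ q, IsClosed (F q) := by
    intro q
    have e : F q = {z | s ^ q * |z.1.1 q - z.2.1 q| ≤ 1 / ((q : ℝ) + 1)} ∩
        {z | ε ≤ |G z.1 - G z.2|} := rfl
    rw [e]
    refine IsClosed.inter (isClosed_le ?_ continuous_const) (isClosed_le continuous_const ?_)
    · exact continuous_const.mul (((proj_cont s q).comp continuous_fst).sub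
        ((proj_cont s q).comp continuous_snd)).abs
    · exact ((hG.comp continuous_fst).sub (hG.comp continuous_snd)).abs
  have hne : (⋂ q, F q).Nonempty := by
    refine IsCompact.nonempty_iInter_of_sequence_nonempty_isCompact_isClosed F ?_ ?_
      (hcl 0).isCompact hcl
    · rintro q z ⟨h1, h2⟩
      refine ⟨le_trans (K_lip C z.1 z.2 (Nat.le_succ q)) (le_trans h1 ?_), h2⟩
      exact one_div_le_one_div_of_le (by positivity) (by push_cast; linarith)
    · intro q
      obtain ⟨x, y, h1, h2⟩ := hc q
      exact ⟨(x, y), h1, h2⟩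
  obtain ⟨⟨x, y⟩, hxy⟩ := hne
  rw [mem_iInter] at hxy
  have heq : x = y := by
    apply Subtype.ext
    funext m
    by_contra hm
    have hpos : 0 < s ^ m * |x.1 m - y.1 m| := mul_pos (C.b0 m) (abs_pos.2 (sub_ne_zero.2 hm))
    obtain ⟨n, hn⟩ := exists_nat_one_div_lt hpos
    have h1 := (hxy (m + n)).1
    have h2 := K_lip C x y (show m ≤ m + n by omega)
    have h3 : 1 / (((m + n : ℕ) : ℝ) + 1) ≤ 1 / ((n : ℝ) + 1) :=
      one_div_le_one_div_of_le (by positivity) (by push_cast; linarith [Nat.cast_nonneg (α := ℝ) m])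
    simp only at h1
    linarith
  have := (hxy 0).2
  simp only [heq, sub_self, abs_zero] at this
  linarith

theorem phi_scale {s δ : ℝ} (C : Ctx s δ) {t : ℝ} (ht : 0 ≤ t) (n : ℕ) :
    s ^ n * (phi C t).1 n = ff s n t := by
  have := C.b0 n
  rw [phi_apply C ht]; field_simp

theorem exists_GU {s δ : ℝ} (C : Ctx s δ) (h : invLim s ≃ₜ invLim s) (g : ℝ ≃o ℝ) (h0 : g 0 = 0)
    (hg : ∀ t, 0 ≤ t → h (phi C t) = phi C (g t)) : GU s g := by
  refine ⟨h0, fun p ε hε => ?_⟩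
  have hc : Continuous fun x : invLim s => s ^ p * (h x).1 p :=
    continuous_const.mul ((proj_cont s p).comp h.continuous)
  obtain ⟨q, hq⟩ := K_uc C _ hc hε
  refine ⟨q, 1 / ((q : ℝ) + 1), by positivity, fun t t' ht ht' htt => ?_⟩
  have gn : ∀ t, 0 ≤ t → 0 ≤ g t := fun t ht => by rw [← h0]; exact g.monotone ht
  have := hq (phi C t) (phi C t') (by
    rw [← abs_of_pos (C.b0 q), ← abs_mul, mul_sub, phi_scale C ht, phi_scale C ht']
    exact htt)
  rw [hg t ht, hg t' ht', phi_scale C (gn t ht), phi_scale C (gn t' ht')] at this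
  exact this.le

theorem g_symm {s δ : ℝ} (C : Ctx s δ) (h : invLim s ≃ₜ invLim s) (g : ℝ ≃o ℝ) (h0 : g 0 = 0)
    (hg : ∀ t, 0 ≤ t → h (phi C t) = phi C (g t)) :
    g.symm 0 = 0 ∧ ∀ t, 0 ≤ t → h.symm (phi C t) = phi C (g.symm t) := by
  have h1 : g.symm 0 = 0 := by rw [← h0, g.symm_apply_apply, h0]
  refine ⟨h1, fun t ht => ?_⟩
  have h2 : 0 ≤ g.symm t := by rw [← h1]; exact g.symm.monotone ht
  rw [h.symm_apply_eq, hg _ h2, g.apply_symm_apply]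

/-- symmetric clamp -/
def cl (c d : ℝ) : ℝ := max (min d c) (-c)

theorem cl_lip (c d d' : ℝ) : |cl c d - cl c d'| ≤ |d - d'| := by
  refine le_trans (abs_max_sub_max_le_max _ _ _ _) ?_
  rw [sub_self, abs_zero]
  refine max_le (le_trans (abs_min_sub_min_le_max _ _ _ _) ?_) (abs_nonneg _)
  rw [sub_self, abs_zero]
  exact max_le le_rfl (abs_nonneg _)

theorem cl_pos {c d : ℝ} (hc : 0 ≤ c) (hd : 0 ≤ d) : cl c d = min d c :=
  max_eq_left (le_trans (by linarith) (le_min hd hc))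

theorem cl_neg (c d : ℝ) (hc : 0 ≤ c) : cl c (-d) = - cl c d := by
  unfold cl
  rcases le_total d c with h1 | h1 <;> rcases le_total (-c) d with h2 | h2
  · rw [min_eq_left h1, max_eq_left h2, min_eq_left (by linarith), max_eq_left (by linarith)]
  · rw [min_eq_left h1, max_eq_right h2, min_eq_right (by linarith), max_eq_left (by linarith)]
    ring
  · rw [min_eq_right h1, min_eq_left (show -d ≤ c by linarith),
      max_eq_right (show -d ≤ -c by linarith), max_eq_left (show -c ≤ c by linarith)]
  · have : c = 0 := by linarith
    subst this
    have : d = 0 := by linarith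
    subst this
    simp

theorem cl_sign {c d σ : ℝ} (hc : 0 ≤ c) (hσ : σ = 1 ∨ σ = -1) : cl c (σ * d) = σ * cl c d := by
  rcases hσ with rfl | rfl
  · simp
  · rw [neg_one_mul, neg_one_mul, cl_neg c d hc]

theorem cl_zero (d : ℝ) : cl 0 d = 0 := by simp [cl]

theorem cl_id {c d : ℝ} (h : |d| ≤ c) : cl c d = d := by
  rw [abs_le] at h
  rw [cl, min_eq_left h.2, max_eq_left h.1]

theorem cl_cont : Continuous fun z : ℝ × ℝ => cl z.1 z.2 := by
  unfold cl; fun_prop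

/-- clamped ray map -/
def HH (g : ℝ → ℝ) (c t : ℝ) : ℝ := t + cl c (g t - t)

theorem HH_nonneg {g : ℝ → ℝ} {c t : ℝ} (hc : 0 ≤ c) (ht : 0 ≤ t) (hg : 0 ≤ g t) :
    0 ≤ HH g c t := by
  have : min (g t - t) c ≤ cl c (g t - t) := le_max_left _ _
  have h2 : -t ≤ min (g t - t) c := le_min (by linarith) (by linarith)
  unfold HH
  linarith

theorem HH_inv (g : ℝ ≃o ℝ) {c t : ℝ} (hc : 0 ≤ c) : HH g.symm c (HH g c t) = t := by
  rcases lt_or_ge c (g t - t) with h1 | h1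
  · have e : HH g c t = t + c := by
      rw [HH, cl_pos hc (by linarith), min_eq_right h1.le]
    have h2 : g.symm (t + c) ≤ t := by
      rw [g.symm_apply_le]; linarith
    rw [e, HH, cl, min_eq_left (by linarith), max_eq_right (by linarith)]
    ring
  rcases lt_or_ge (g t - t) (-c) with h3 | h3
  · have e : HH g c t = t - c := by
      rw [HH, cl, min_eq_left h1, max_eq_right h3.le]; ring
    have h2 : t ≤ g.symm (t - c) := by
      rw [g.le_symm_apply]; linarith
    rw [e, HH, cl, min_eq_right (by linarith), max_eq_left (by linarith)]
    ring
  · have e : HH g c t = g t := by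
      rw [HH, cl_id (abs_le.2 ⟨h3, h1⟩)]; ring
    rw [e, HH, g.symm_apply_apply, cl_id (abs_le.2 ⟨by linarith, by linarith⟩)]
    ring

theorem cl_mem {c d : ℝ} (hc : 0 ≤ c) (hd : 0 ≤ d) : 0 ≤ cl c d ∧ cl c d ≤ d := by
  rw [cl_pos hc hd]
  exact ⟨le_min hd hc, min_le_left _ _⟩

theorem cl_mem_neg {c d : ℝ} (hc : 0 ≤ c) (hd : d ≤ 0) : d ≤ cl c d ∧ cl c d ≤ 0 := by
  have h := cl_mem hc (show 0 ≤ -d by linarith)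
  rw [cl_neg c d hc] at h
  exact ⟨by linarith [h.2], by linarith [h.1]⟩

theorem key_aux {s δ : ℝ} (C : Ctx s δ) (P : ℕ) {t w y c ε σ : ℝ} (hc : 0 ≤ c)
    (hwy : |w - y| ≤ ε) (hσ : σ = 1 ∨ σ = -1)
    (haff : ∀ v ∈ uIcc t y, ff s P v = ff s P t + σ * (v - t)) :
    |ff s P (t + cl c (w - t)) - (ff s P t + cl c (ff s P w - ff s P t))| ≤ 2 * ε := by
  have hm : t + cl c (y - t) ∈ uIcc t y := by
    rcases le_total t y with h | h
    · have := cl_mem hc (show 0 ≤ y - t by linarith)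
      rw [uIcc_of_le h]
      exact ⟨by linarith [this.1], by linarith [this.2]⟩
    · have := cl_mem_neg hc (show y - t ≤ 0 by linarith)
      rw [uIcc_of_ge h]
      exact ⟨by linarith [this.1], by linarith [this.2]⟩
  have h1 := haff _ hm
  have h2 := haff y right_mem_uIcc
  have h3 : cl c (ff s P y - ff s P t) = σ * cl c (y - t) := by
    rw [h2, ← cl_sign hc hσ]; congr 1; ring
  have h4 := ff_lip C P (t + cl c (w - t)) (t + cl c (y - t))
  have h5 := cl_lip c (w - t) (y - t)
  have h6 := cl_lip c (ff s P w - ff s P t) (ff s P y - ff s P t)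
  have h7 := ff_lip C P w y
  rw [sub_sub_sub_cancel_right] at h5 h6
  rw [add_sub_add_left_eq_sub] at h4
  rw [h3] at h6
  rw [add_sub_cancel_left] at h1
  have h8 := le_trans h4 (le_trans h5 hwy)
  have h9 := le_trans h6 (le_trans h7 hwy)
  rw [abs_le] at h8 h9 ⊢
  constructor <;> linarith [h8.1, h8.2, h9.1, h9.2]

/-- the ray map is close to the identity at deep turning points -/
def Near (s : ℝ) (g : ℝ → ℝ) : Prop :=
  ∀ ε : ℝ, 0 < ε → ∃ N : ℕ, ∀ r, N ≤ r → ∀ t ∈ EE s r, |g t - t| ≤ ε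

theorem key {s δ : ℝ} (C : Ctx s δ) (g : ℝ ≃o ℝ) (hN : Near s g) {ε : ℝ} (hε : 0 < ε) :
    ∃ N : ℕ, ∀ P, N ≤ P → ∀ t c : ℝ, 0 ≤ c →
      |ff s P (HH g c t) - (ff s P t + cl c (ff s P (g t) - ff s P t))| ≤ ε := by
  have hd := C.hd0
  obtain ⟨N, hN⟩ := hN (min (ε / 2) (δ / 2)) (by positivity)
  have m1 := min_le_left (ε / 2) (δ / 2)
  have m2 := min_le_right (ε / 2) (δ / 2)
  refine ⟨N, fun P hP t c hc => ?_⟩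
  have gap : ∀ i j, P < i → P < j → ∀ x ∈ EE s i, ∀ z ∈ EE s j, x ≠ z → δ ≤ |x - z| := by
    intro i j hi hj x hx z hz hne
    simpa using EE_gap C (p := 0) (by omega) (by omega) hx hz hne
  have fin : ∀ y, |g t - y| ≤ ε / 2 → (∃ σ : ℝ, (σ = 1 ∨ σ = -1) ∧
      ∀ v ∈ uIcc t y, ff s P v = ff s P t + σ * (v - t)) →
      |ff s P (HH g c t) - (ff s P t + cl c (ff s P (g t) - ff s P t))| ≤ ε := by
    rintro y hy ⟨σ, hσ, haff⟩
    have := key_aux C P hc hy hσ haff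
    unfold HH
    linarith
  have up : ∀ y, t ≤ y → (∀ i, P < i → ∀ z ∈ Ioo t y, z ∉ EE s i) →
      (∃ σ : ℝ, (σ = 1 ∨ σ = -1) ∧ ∀ v ∈ uIcc t y, ff s P v = ff s P t + σ * (v - t)) := by
    intro y hy hno
    rw [uIcc_of_le hy]
    exact ff_affine C P hy hno
  have dn : ∀ y, y ≤ t → (∀ i, P < i → ∀ z ∈ Ioo y t, z ∉ EE s i) →
      (∃ σ : ℝ, (σ = 1 ∨ σ = -1) ∧ ∀ v ∈ uIcc t y, ff s P v = ff s P t + σ * (v - t)) := by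
    intro y hy hno
    rw [uIcc_of_ge hy]
    obtain ⟨σ, hσ, h⟩ := ff_affine C P hy hno
    refine ⟨σ, hσ, fun v hv => ?_⟩
    rw [h v hv, h t ⟨hy, le_rfl⟩]
    ring
  rcases le_total t (g t) with ht | ht
  · by_cases hex : ∃ i, P < i ∧ ∃ z ∈ Ioo t (g t), z ∈ EE s i
    · obtain ⟨i, hi, z, hz, hzi⟩ := hex
      have ov : ∀ j, P < j → ∀ x ∈ EE s j, t < x → g t ≤ x + min (ε / 2) (δ / 2) := by
        intro j hj x hx htx
        have h1 := g.strictMono htx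
        have h2 := hN j (by omega) x hx
        rw [abs_le] at h2
        linarith [h2.2]
      have hov := ov i hi z hzi hz.1
      refine fin z (abs_le.2 ⟨by linarith [hz.2], by linarith⟩) (up z hz.1.le ?_)
      intro j hj x hx hxj
      have h1 := ov j hj x hxj hx.1
      have h2 := gap j i hj hi x hxj z hzi hx.2.ne
      rw [abs_of_neg (by linarith [hx.2])] at h2
      linarith [hz.2]
    · push Not at hex
      exact fin (g t) (by simp; linarith) (up _ ht hex)
  · by_cases hex : ∃ i, P < i ∧ ∃ z ∈ Ioo (g t) t, z ∈ EE s i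
    · obtain ⟨i, hi, z, hz, hzi⟩ := hex
      have ov : ∀ j, P < j → ∀ x ∈ EE s j, x < t → x - min (ε / 2) (δ / 2) ≤ g t := by
        intro j hj x hx htx
        have h1 := g.strictMono htx
        have h2 := hN j (by omega) x hx
        rw [abs_le] at h2
        linarith [h2.1]
      have hov := ov i hi z hzi hz.2
      refine fin z (abs_le.2 ⟨by linarith, by linarith [hz.1]⟩) (dn z hz.2.le ?_)
      intro j hj x hx hxj
      have h1 := ov j hj x hxj hx.2
      have h2 := gap j i hj hi x hxj z hzi hx.1.ne'
      rw [abs_of_pos (by linarith [hx.1])] at h2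
      linarith [hz.1]
    · push Not at hex
      exact fin (g t) (by simp; linarith) (dn _ ht hex)

theorem gap_bound {s δ : ℝ} (C : Ctx s δ) (N : ℕ) {x : ℝ} (hx : 0 ≤ x) :
    ∃ i, N < i ∧ ∃ z ∈ Ioo x (x + s ^ (N + 1)), z ∈ EE s i := by
  by_contra hc
  push Not at hc
  have hb := C.b0 (N + 1)
  obtain ⟨σ, hσ, h⟩ := ff_affine C N (show x ≤ x + s ^ (N + 1) by linarith) hc
  have h1 := h (x + s ^ (N + 1)) ⟨by linarith, le_rfl⟩
  have h2 := ff_le C N x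
  have h3 := ff_le C N (x + s ^ (N + 1))
  have h4 := ff_nonneg C N hx
  have h5 := ff_nonneg C N (show 0 ≤ x + s ^ (N + 1) by linarith)
  rcases hσ with rfl | rfl <;> linarith

theorem bdd {s δ : ℝ} (C : Ctx s δ) (g : ℝ ≃o ℝ) (h0 : g 0 = 0) (hN : Near s g) :
    ∃ M : ℝ, 0 ≤ M ∧ ∀ t, 0 ≤ t → |g t - t| ≤ M := by
  obtain ⟨N, hN⟩ := hN 1 one_pos
  have hb := C.b0 (N + 1)
  refine ⟨s ^ (N + 1) + 1, by positivity, fun t ht => abs_le.2 ⟨?_, ?_⟩⟩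
  · rcases lt_or_ge t (s ^ (N + 1)) with h | h
    · have : 0 ≤ g t := by rw [← h0]; exact g.monotone ht
      linarith
    · obtain ⟨i, hi, z, hz, hzi⟩ := gap_bound C N (show 0 ≤ t - s ^ (N + 1) by linarith)
      have h1 := abs_le.1 (hN i hi.le z hzi)
      have h2 := g.monotone (show z ≤ t by linarith [hz.2])
      linarith [hz.1, h1.1]
  · obtain ⟨i, hi, z, hz, hzi⟩ := gap_bound C N ht
    have h1 := abs_le.1 (hN i hi.le z hzi)
    have h2 := g.monotone hz.1.le
    linarith [hz.2, h1.2]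

theorem near_symm {s δ : ℝ} (C : Ctx s δ) (g : ℝ ≃o ℝ) (G : GU s g) (G' : GU s g.symm)
    (hN : Near s g) : Near s g.symm := by
  intro ε hε
  obtain ⟨κ, hκ, hlu⟩ := G'.lu C hε
  obtain ⟨N, hN⟩ := hN κ hκ
  refine ⟨N, fun r hr t ht => ?_⟩
  have h1 := hN r hr t ht
  have t0 : 0 ≤ t := le_trans (by have := C.b0 r; positivity) (EE_ge C ht)
  have h2 := hlu (g t) t (G.nonneg t0) t0 h1
  rwa [g.symm_apply_apply, abs_sub_comm] at h2

theorem extend_ray {s δ : ℝ} (C : Ctx s δ) (Ψ : unitInterval → ℝ → ℝ)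
    (hΨ : ∀ c t, 0 ≤ t → 0 ≤ Ψ c t) (A : ℕ → invLim s × unitInterval → ℝ)
    (hA : ∀ P, Continuous (A P))
    (hk : ∀ ε : ℝ, 0 < ε → ∃ N : ℕ, ∀ P, N ≤ P → ∀ t c, 0 ≤ t →
      |ff s P (Ψ c t) - A P (phi C t, c)| ≤ ε) :
    ∃ F : invLim s × unitInterval → invLim s, Continuous F ∧
      ∀ t c, 0 ≤ t → F (phi C t, c) = phi C (Ψ c t) := by
  have := invLim_compact s
  let Good : ℝ → ℕ → Prop := fun ε P => ∀ t c, 0 ≤ t → |ff s P (Ψ c t) - A P (phi C t, c)| ≤ ε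
  let R : Set ((invLim s × unitInterval) × invLim s) :=
    {z | ∀ ε P, Good ε P → |s ^ P * z.2.1 P - A P z.1| ≤ ε}
  have hR : IsClosed R := by
    have : R = ⋂ ε, ⋂ P, ⋂ _ : Good ε P, {z | |s ^ P * z.2.1 P - A P z.1| ≤ ε} := by
      ext z; simp [R]
    rw [this]
    refine isClosed_iInter fun ε => isClosed_iInter fun P => isClosed_iInter fun _ =>
      isClosed_le ?_ continuous_const
    exact ((continuous_const.mul ((proj_cont s P).comp continuous_snd)).sub
      ((hA P).comp continuous_fst)).abs
  have hray : ∀ t c, 0 ≤ t → ((phi C t, c), phi C (Ψ c t)) ∈ R := by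
    intro t c ht ε P hg
    show |s ^ P * (phi C (Ψ c t)).1 P - A P (phi C t, c)| ≤ ε
    rw [phi_scale C (hΨ c t ht)]
    exact hg t c ht
  have huniq : ∀ x y y', (x, y) ∈ R → (x, y') ∈ R → y = y' := by
    intro x y y' h h'
    apply Subtype.ext
    funext m
    by_contra hm
    have hpos : 0 < s ^ m * |y.1 m - y'.1 m| := mul_pos (C.b0 m) (abs_pos.2 (sub_ne_zero.2 hm))
    obtain ⟨N, hN⟩ := hk (s ^ m * |y.1 m - y'.1 m| / 4) (by positivity)
    have g1 := hN (m + N) (by omega)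
    have h1 := h _ _ g1
    have h2 := h' _ _ g1
    have h3 := K_lip C y y' (show m ≤ m + N by omega)
    rw [← abs_of_pos (C.b0 (m + N)), ← abs_mul, mul_sub] at h3
    have h4 := abs_sub_le (s ^ (m + N) * y.1 (m + N)) (A (m + N) x) (s ^ (m + N) * y'.1 (m + N))
    rw [abs_sub_comm (A (m + N) x)] at h4
    simp only at h1 h2
    linarith
  have hex : ∀ x, ∃ y, (x, y) ∈ R := by
    have hcl : IsClosed (Prod.fst '' R) := (hR.isCompact.image continuous_fst).isClosed
    have hd : Dense (Prod.fst '' R) := by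
      refine ((C0_dense C).prod (dense_univ (X := unitInterval))).mono ?_
      rintro ⟨x, c⟩ ⟨hx, -⟩
      obtain ⟨t, ht, rfl⟩ := C0_exists C hx
      exact ⟨_, hray t c ht, rfl⟩
    intro x
    have : x ∈ Prod.fst '' R := by
      have := hd x
      rwa [hcl.closure_eq] at this
    obtain ⟨⟨x', y⟩, h, rfl⟩ := this
    exact ⟨y, h⟩
  choose F hF using hex
  refine ⟨F, ?_, fun t c ht => huniq _ _ _ (hF _) (hray t c ht)⟩
  refine continuous_iff_isClosed.2 fun Z hZ => ?_
  have e : F ⁻¹' Z = Prod.fst '' (R ∩ Prod.snd ⁻¹' Z) := by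
    ext x
    constructor
    · intro hx
      exact ⟨(x, F x), ⟨hF x, hx⟩, rfl⟩
    · rintro ⟨⟨x', y⟩, ⟨h1, h2⟩, rfl⟩
      show F x' ∈ Z
      rw [huniq _ _ _ (hF x') h1]
      exact h2
  rw [e]
  exact ((hR.inter (hZ.preimage continuous_snd)).isCompact.image continuous_fst).isClosed

theorem clamp_ext {s δ : ℝ} (C : Ctx s δ) (h : invLim s ≃ₜ invLim s) (g : ℝ ≃o ℝ) (h0 : g 0 = 0)
    (hg : ∀ t, 0 ≤ t → h (phi C t) = phi C (g t)) (hN : Near s g) {M : ℝ} (hM : 0 ≤ M) :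
    ∃ F : invLim s × unitInterval → invLim s, Continuous F ∧
      ∀ t (c : unitInterval), 0 ≤ t → F (phi C t, c) = phi C (HH g (M * (1 - (c : ℝ))) t) := by
  have gn : ∀ t, 0 ≤ t → 0 ≤ g t := fun t ht => by rw [← h0]; exact g.monotone ht
  have cn : ∀ c : unitInterval, 0 ≤ M * (1 - (c : ℝ)) := fun c =>
    mul_nonneg hM (by linarith [c.2.2])
  refine extend_ray C (fun c t => HH g (M * (1 - (c : ℝ))) t)
    (fun c t ht => HH_nonneg (cn c) ht (gn t ht))
    (fun P z => s ^ P * z.1.1 P + cl (M * (1 - (z.2 : ℝ))) (s ^ P * (h z.1).1 P - s ^ P * z.1.1 P))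
    ?_ ?_
  · intro P
    have c1 : Continuous fun z : invLim s × unitInterval => s ^ P * z.1.1 P :=
      continuous_const.mul ((proj_cont s P).comp continuous_fst)
    have c2 : Continuous fun z : invLim s × unitInterval => s ^ P * (h z.1).1 P :=
      continuous_const.mul ((proj_cont s P).comp (h.continuous.comp continuous_fst))
    have c3 : Continuous fun z : invLim s × unitInterval => M * (1 - (z.2 : ℝ)) := by fun_prop
    exact c1.add (cl_cont.comp (c3.prodMk (c2.sub c1)))
  · intro ε hε
    obtain ⟨N, hN⟩ := key C g hN hε
    refine ⟨N, fun P hP t c ht => ?_⟩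
    simp only
    rw [hg t ht, phi_scale C ht, phi_scale C (gn t ht)]
    exact hN P hP t _ (cn c)

theorem eq_of_ray {s δ : ℝ} (C : Ctx s δ) {f f' : invLim s → invLim s} (hf : Continuous f)
    (hf' : Continuous f') (h : ∀ t, 0 ≤ t → f (phi C t) = f' (phi C t)) : f = f' := by
  refine Continuous.ext_on (C0_dense C) hf hf' ?_
  intro x hx
  obtain ⟨t, ht, rfl⟩ := C0_exists C hx
  exact h t ht

theorem isotopy_id {s δ : ℝ} (C : Ctx s δ) (h : invLim s ≃ₜ invLim s) (g : ℝ ≃o ℝ) (h0 : g 0 = 0)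
    (hg : ∀ t, 0 ≤ t → h (phi C t) = phi C (g t)) (hN : Near s g) : Isotopic (⇑h) id := by
  obtain ⟨h0', hg'⟩ := g_symm C h g h0 hg
  have hN' := near_symm C g (exists_GU C h g h0 hg) (exists_GU C h.symm g.symm h0' hg') hN
  obtain ⟨M, hM, hb⟩ := bdd C g h0 hN
  obtain ⟨F, hF, hFr⟩ := clamp_ext C h g h0 hg hN hM
  obtain ⟨F', hF', hFr'⟩ := clamp_ext C h.symm g.symm h0' hg' hN' hM
  have gn : ∀ t, 0 ≤ t → 0 ≤ g t := fun t ht => by rw [← h0]; exact g.monotone ht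
  have gn' : ∀ t, 0 ≤ t → 0 ≤ g.symm t := fun t ht => by rw [← h0']; exact g.symm.monotone ht
  have cn : ∀ c : unitInterval, 0 ≤ M * (1 - (c : ℝ)) := fun c =>
    mul_nonneg hM (by linarith [c.2.2])
  have fc : ∀ c, Continuous fun x => F (x, c) := fun c => hF.comp (by fun_prop)
  have fc' : ∀ c, Continuous fun x => F' (x, c) := fun c => hF'.comp (by fun_prop)
  have i1 : ∀ c x, F' (F (x, c), c) = x := by
    intro c
    refine congrFun (eq_of_ray C (f := fun x => F' (F (x, c), c)) (f' := id)
      ((fc' c).comp (fc c)) continuous_id fun t ht => ?_)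
    simp only [id]
    rw [hFr t c ht, hFr' _ c (HH_nonneg (cn c) ht (gn t ht)), HH_inv g (cn c)]
  have i2 : ∀ c x, F (F' (x, c), c) = x := by
    intro c
    refine congrFun (eq_of_ray C (f := fun x => F (F' (x, c), c)) (f' := id)
      ((fc c).comp (fc' c)) continuous_id fun t ht => ?_)
    simp only [id]
    rw [hFr' t c ht, hFr _ c (HH_nonneg (cn c) ht (gn' t ht))]
    have := HH_inv g.symm (t := t) (cn c)
    rw [g.symm_symm] at this
    rw [this]
  refine ⟨F, hF, ?_, ?_, ?_⟩
  · refine congrFun (eq_of_ray C (fc 0) h.continuous fun t ht => ?_)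
    rw [hFr t 0 ht, hg t ht, HH, cl_id]
    · congr 1; ring
    · simpa using hb t ht
  · refine congrFun (eq_of_ray C (fc 1) continuous_id fun t ht => ?_)
    rw [hFr t 1 ht, HH]
    simp [cl_zero]
  · intro c
    exact (Homeomorph.mk ⟨fun x => F (x, c), fun x => F' (x, c), i1 c, i2 c⟩
      (fc c) (fc' c)).isHomeomorph

theorem shift_inv_ray {s δ : ℝ} (C : Ctx s δ) {t : ℝ} (ht : 0 ≤ t) :
    shiftInvFun s (phi C t) = phi C (t / s) := by
  have hs := C.s0
  apply Subtype.ext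
  funext n
  show (phi C t).1 (n + 1) = (phi C (t / s)).1 n
  rw [phi_apply C ht, phi_apply C (by positivity)]
  have := ff_scale C n 1 (t / s)
  rw [pow_one, show s * (t / s) = t by field_simp] at this
  have hb := C.b0 n
  rw [this, pow_succ]
  field_simp

theorem shift_left {s : ℝ} (hs1 : Real.sqrt 2 < s) (hs2 : s < 2) (x : invLim s) :
    shiftInvFun s (shiftFwdFun s hs1 hs2 x) = x := by
  apply Subtype.ext
  funext n
  rfl

theorem shift_right {s : ℝ} (hs1 : Real.sqrt 2 < s) (hs2 : s < 2) (x : invLim s) :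
    shiftFwdFun s hs1 hs2 (shiftInvFun s x) = x := by
  apply Subtype.ext
  funext n
  cases n with
  | zero => exact (x.2.2 0).symm
  | succ n => rfl

theorem shift_inv_cont (s : ℝ) : Continuous (shiftInvFun s) :=
  Continuous.subtype_mk (continuous_pi fun n => proj_cont s (n + 1)) _

theorem shift_fwd_cont {s : ℝ} (hs1 : Real.sqrt 2 < s) (hs2 : s < 2) :
    Continuous (shiftFwdFun s hs1 hs2) := by
  refine Continuous.subtype_mk (continuous_pi fun n => ?_) _
  cases n with
  | zero => exact (tent_cont s).comp (proj_cont s 0)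
  | succ n => exact proj_cont s n

theorem shift_fwd_ray {s δ : ℝ} (C : Ctx s δ) (hs1 : Real.sqrt 2 < s) (hs2 : s < 2) {t : ℝ}
    (ht : 0 ≤ t) : shiftFwdFun s hs1 hs2 (phi C t) = phi C (s * t) := by
  have hs := C.s0
  have h1 := shift_inv_ray C (show 0 ≤ s * t by positivity)
  rw [show s * t / s = t by field_simp] at h1
  rw [← h1, shift_right]

theorem pow_fwd {s δ : ℝ} (C : Ctx s δ) (hs1 : Real.sqrt 2 < s) (hs2 : s < 2) (n : ℕ) :
    ∃ S : invLim s ≃ₜ invLim s, ⇑S = (shiftFwdFun s hs1 hs2)^[n] ∧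
      ∀ t, 0 ≤ t → S (phi C t) = phi C (s ^ n * t) := by
  induction n with
  | zero => exact ⟨Homeomorph.refl _, rfl, fun t _ => by simp⟩
  | succ n ih =>
    obtain ⟨S, h1, h2⟩ := ih
    refine ⟨(Homeomorph.mk ⟨shiftFwdFun s hs1 hs2, shiftInvFun s, shift_left hs1 hs2,
      shift_right hs1 hs2⟩ (shift_fwd_cont hs1 hs2) (shift_inv_cont s)).trans S, ?_, ?_⟩
    · funext x
      show S (shiftFwdFun s hs1 hs2 x) = _
      rw [h1, Function.iterate_succ_apply]
    · intro t ht
      show S (shiftFwdFun s hs1 hs2 (phi C t)) = _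
      rw [shift_fwd_ray C hs1 hs2 ht, h2 _ (mul_nonneg C.s0.le ht), pow_succ, mul_assoc]

theorem pow_inv {s δ : ℝ} (C : Ctx s δ) (hs1 : Real.sqrt 2 < s) (hs2 : s < 2) (n : ℕ) :
    ∃ S : invLim s ≃ₜ invLim s, ⇑S = (shiftInvFun s)^[n] ∧
      ∀ t, 0 ≤ t → S (phi C t) = phi C (t / s ^ n) := by
  induction n with
  | zero => exact ⟨Homeomorph.refl _, rfl, fun t _ => by simp⟩
  | succ n ih =>
    obtain ⟨S, h1, h2⟩ := ih
    refine ⟨(Homeomorph.mk ⟨shiftInvFun s, shiftFwdFun s hs1 hs2, shift_right hs1 hs2,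
      shift_left hs1 hs2⟩ (shift_inv_cont s) (shift_fwd_cont hs1 hs2)).trans S, ?_, ?_⟩
    · funext x
      show S (shiftInvFun s x) = _
      rw [h1, Function.iterate_succ_apply]
    · intro t ht
      show S (shiftInvFun s (phi C t)) = _
      rw [shift_inv_ray C ht, h2 _ (div_nonneg ht C.s0.le), pow_succ', div_div]

theorem shiftZ_homeo {s δ : ℝ} (C : Ctx s δ) (hs1 : Real.sqrt 2 < s) (hs2 : s < 2) (J L : ℕ) :
    ∃ S : invLim s ≃ₜ invLim s, ⇑S = shiftZ s hs1 hs2 ((L : ℤ) - J) ∧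
      ∀ t, 0 ≤ t → S (phi C t) = phi C (s ^ L / s ^ J * t) := by
  have hJ := C.b0 J
  have hL := C.b0 L
  by_cases h : 0 ≤ (L : ℤ) - J
  · obtain ⟨k, rfl⟩ := Nat.exists_eq_add_of_le (show J ≤ L by omega)
    obtain ⟨S, h1, h2⟩ := pow_fwd C hs1 hs2 k
    refine ⟨S, ?_, fun t ht => ?_⟩
    · rw [h1, shiftZ, if_pos h]; congr 1; omega
    · rw [h2 t ht, pow_add]; congr 1; field_simp
  · obtain ⟨k, rfl⟩ := Nat.exists_eq_add_of_le (show L ≤ J by omega)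
    obtain ⟨S, h1, h2⟩ := pow_inv C hs1 hs2 k
    have hk := C.b0 k
    refine ⟨S, ?_, fun t ht => ?_⟩
    · rw [h1, shiftZ, if_neg h]; congr 1; omega
    · rw [h2 t ht, pow_add]; congr 1; field_simp

theorem main_aux (s : ℝ) (hs1 : Real.sqrt 2 < s) (hs2 : s < 2)
    (hnr : (1 : ℝ) / 2 ∉ omegaSet (tent s) (1 / 2))
    (h : invLim s ≃ₜ invLim s) :
    ∃ a : ℤ, Isotopic (⇑h) (shiftZ s hs1 hs2 a) := by
  have h1 : 1 < s := by
    have : (1 : ℝ) ≤ Real.sqrt 2 := Real.one_le_sqrt.2 (by norm_num)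
    linarith
  obtain ⟨δ, C⟩ := exists_ctx s h1 hs2 hnr
  obtain ⟨g, h0, hg⟩ := exists_g C h
  obtain ⟨h0', hg'⟩ := g_symm C h g h0 hg
  obtain ⟨J, L, hJL⟩ := asymp C (exists_GU C h g h0 hg) (exists_GU C h.symm g.symm h0' hg')
  obtain ⟨S, hS, hSr⟩ := shiftZ_homeo C hs1 hs2 J L
  refine ⟨(L : ℤ) - J, ?_⟩
  rw [← hS]
  have hρ : 0 < s ^ L / s ^ J := div_pos (C.b0 L) (C.b0 J)
  set ρ := s ^ L / s ^ J with hρdef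
  obtain ⟨g1, k0, kg⟩ := exists_g C (h.trans S.symm)
  have gn : ∀ t, 0 ≤ t → 0 ≤ g t := fun t ht => by rw [← h0]; exact g.monotone ht
  have gn1 : ∀ t, 0 ≤ t → 0 ≤ g1 t := fun t ht => by rw [← k0]; exact g1.monotone ht
  have rel : ∀ t, 0 ≤ t → g t = ρ * g1 t := by
    intro t ht
    have e1 : S ((h.trans S.symm) (phi C t)) = h (phi C t) := by simp
    rw [kg t ht, hSr _ (gn1 t ht), hg t ht] at e1
    exact (phi_inj C (mul_nonneg hρ.le (gn1 t ht)) (gn t ht) e1).symm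
  have hN : Near s g1 := by
    intro ε hε
    obtain ⟨N, hN⟩ := hJL (ρ * ε) (by positivity)
    refine ⟨N, fun r hr t ht => ?_⟩
    have t0 : 0 ≤ t := le_trans (by have := C.b0 r; positivity) (EE_ge C ht)
    have h2 := hN r hr t ht
    rw [rel t t0, ← mul_sub, abs_mul, abs_of_pos hρ] at h2
    exact le_of_mul_le_mul_left h2 hρ
  obtain ⟨F, hF, hF0, hF1, hFh⟩ := isotopy_id C (h.trans S.symm) g1 k0 kg hN
  refine ⟨fun z => S (F z), S.continuous.comp hF, fun x => ?_, fun x => ?_, fun c => ?_⟩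
  · simp [hF0]
  · simp [hF1]
  · exact S.isHomeomorph.comp (hFh c)

/-- every homeomorphism of `K` is isotopic to an integer power of the shift. -/
theorem statement0 (s : ℝ) (hs1 : Real.sqrt 2 < s) (hs2 : s < 2)
    (hnr : (1 : ℝ) / 2 ∉ omegaSet (tent s) (1 / 2))
    (h : invLim s ≃ₜ invLim s) :
    ∃ a : ℤ, Isotopic (⇑h) (shiftZ s hs1 hs2 a) := by
  exact main_aux s hs1 hs2 hnr h
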